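/- arXiv:1005.4303 — 5 statements merged into one kernel-verified Lean document; each statement's English description precedes it below -/
import Mathlib

section
/- Let Γ be an infinite set. The map g : B⁺(Γ × {0,1}) → B(Γ) defined by g(x)_i = x_{(i,0)} - x_{(i,1)} is a continuous surjection, and the map u : B(Γ) → B⁺(Γ × {0,1}) defined by u(x)_{(i,0)} = max(x_i, 0) and u(x)_{(i,1)} = max(-x_i, 0) is a continuous right inverse of g (i.e. g ∘ u = id). Consequently, B(Γ) is homeomorphic to a retract of B⁺(Γ). -/
open Set Filter Topology

noncomputable section

/-- `Ball ι` is the "hilbertian ball" `B(ι) = {x ∈ ℝ^ι : ∑_i |x i| ≤ 1}` (expressed via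
finite partial sums), carrying the topology inherited from the product topology on `ι → ℝ`. -/
def Ball (ι : Type*) : Set (ι → ℝ) :=
  {x | ∀ s : Finset ι, ∑ i ∈ s, |x i| ≤ 1}

/-- `PosBall ι` is the positive cone `B⁺(ι) = {x ∈ B(ι) : x i ≥ 0 for all i}`. -/
def PosBall (ι : Type*) : Set (ι → ℝ) :=
  {x | x ∈ Ball ι ∧ ∀ i, 0 ≤ x i}

theorem g_mapsTo {Γ : Type*} :
    Set.MapsTo (fun (x : Γ × Bool → ℝ) (i : Γ) => x (i, false) - x (i, true))
       (PosBall (Γ × Bool)) (Ball Γ) := by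
  intro x hx s
  have h := hx.1 (s ×ˢ Finset.univ)
  rw [Finset.sum_product] at h
  refine le_trans (Finset.sum_le_sum fun i _ => ?_) h
  simp only [Fintype.sum_bool]
  rw [add_comm]
  exact abs_sub _ _

theorem u_mapsTo {Γ : Type*} :
    Set.MapsTo (fun (x : Γ → ℝ) (p : Γ × Bool) =>
       if p.2 then max (-(x p.1)) 0 else max (x p.1) 0) (Ball Γ) (PosBall (Γ × Bool)) := by
  classical
  intro x hx
  refine ⟨fun s => ?_, fun p => ?_⟩
  · refine le_trans ?_ (hx (s.image Prod.fst))
    have hs : s ⊆ (s.image Prod.fst) ×ˢ (Finset.univ : Finset Bool) := by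
      intro p hp
      simp only [Finset.mem_product, Finset.mem_univ, and_true]
      exact Finset.mem_image_of_mem _ hp
    refine le_trans (Finset.sum_le_sum_of_subset_of_nonneg hs fun _ _ _ => abs_nonneg _) ?_
    rw [Finset.sum_product]
    refine Finset.sum_le_sum fun i _ => ?_
    simp only [Fintype.sum_bool]
    rcases le_total 0 (x i) with h | h
    · simp [h]
    · simp [h]
  · dsimp only
    split_ifs <;> exact le_max_right _ _

theorem g_u {Γ : Type*} (x : Γ → ℝ) : (fun i : Γ =>
        (fun p : Γ × Bool => if p.2 then max (-(x p.1)) 0 else max (x p.1) 0) (i, false) -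
        (fun p : Γ × Bool => if p.2 then max (-(x p.1)) 0 else max (x p.1) 0) (i, true)) = x := by
  funext i
  rcases le_total 0 (x i) with h | h <;> simp [h]

theorem u_cont {Γ : Type*} : Continuous (fun (x : Γ → ℝ) (p : Γ × Bool) =>
       if p.2 then max (-(x p.1)) 0 else max (x p.1) 0) := by
  refine continuous_pi fun p => ?_
  rcases p with ⟨i, _ | _⟩
  · simp only [Bool.false_eq_true, if_false]
    fun_prop
  · simp only [if_true]
    fun_prop

theorem posBall_comp {α β : Type*} (e : α ≃ β) {x : β → ℝ} (hx : x ∈ PosBall β) :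
    (fun a => x (e a)) ∈ PosBall α := by
  refine ⟨fun s => ?_, fun a => hx.2 _⟩
  have h := hx.1 (s.map e.toEmbedding)
  rw [Finset.sum_map] at h
  exact h

/-- `g : B⁺(Γ × {0,1}) → B(Γ)`, `g(x)_i = x_{(i,0)} - x_{(i,1)}`, is a
continuous surjection with continuous right inverse `u`, `u(x)_{(i,0)} = max (x i) 0`,
`u(x)_{(i,1)} = max (-(x i)) 0`; consequently `B(Γ)` is homeomorphic to a retract of
`B⁺(Γ)` (for infinite `Γ`). Here `{0,1}` is modelled by `Bool` with `0 = false`,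
`1 = true`. -/
theorem statement2 {Γ : Type*} [Infinite Γ] :
    (Continuous (fun (x : Γ × Bool → ℝ) (i : Γ) => x (i, false) - x (i, true)) ∧
     Set.MapsTo (fun (x : Γ × Bool → ℝ) (i : Γ) => x (i, false) - x (i, true))
       (PosBall (Γ × Bool)) (Ball Γ) ∧
     Set.SurjOn (fun (x : Γ × Bool → ℝ) (i : Γ) => x (i, false) - x (i, true))
       (PosBall (Γ × Bool)) (Ball Γ) ∧
     Continuous (fun (x : Γ → ℝ) (p : Γ × Bool) =>
       if p.2 then max (-(x p.1)) 0 else max (x p.1) 0) ∧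
     Set.MapsTo (fun (x : Γ → ℝ) (p : Γ × Bool) =>
       if p.2 then max (-(x p.1)) 0 else max (x p.1) 0) (Ball Γ) (PosBall (Γ × Bool)) ∧
     (∀ x ∈ Ball Γ, (fun i : Γ =>
        (fun p : Γ × Bool => if p.2 then max (-(x p.1)) 0 else max (x p.1) 0) (i, false) -
        (fun p : Γ × Bool => if p.2 then max (-(x p.1)) 0 else max (x p.1) 0) (i, true)) = x)) ∧
    ∃ A : Set ↥(PosBall Γ),
      (∃ r : ↥(PosBall Γ) → ↥(PosBall Γ), Continuous r ∧ Set.range r ⊆ A ∧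
        ∀ a ∈ A, r a = a) ∧
      Nonempty (↥(Ball Γ) ≃ₜ ↥A) := by
  have hg : Continuous (fun (x : Γ × Bool → ℝ) (i : Γ) => x (i, false) - x (i, true)) := by
    fun_prop
  refine ⟨⟨hg, g_mapsTo, fun x hx => ⟨_, u_mapsTo hx, g_u x⟩, u_cont, u_mapsTo,
    fun x _ => g_u x⟩, ?_⟩
  obtain ⟨e⟩ : Nonempty (Γ ≃ Γ × Bool) := by
    have h1 : Cardinal.aleph0 ≤ Cardinal.mk Γ := Cardinal.aleph0_le_mk Γ
    have h : Cardinal.lift.{0} (Cardinal.mk Γ) = Cardinal.mk (Γ × Bool) := by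
      simp only [Cardinal.mk_prod, Cardinal.lift_uzero, Cardinal.mk_bool, Cardinal.lift_ofNat]
      exact (Cardinal.mul_eq_left h1
        ((Cardinal.natCast_lt_aleph0 (n := 2)).le.trans h1) two_ne_zero).symm
    rw [Cardinal.lift_uzero] at h
    exact Cardinal.eq.1 h
  let G : ↥(PosBall Γ) → ↥(Ball Γ) := fun x =>
    ⟨_, g_mapsTo (posBall_comp e.symm x.2)⟩
  let U : ↥(Ball Γ) → ↥(PosBall Γ) := fun x =>
    ⟨_, posBall_comp e (u_mapsTo x.2)⟩
  have hG : Continuous G := by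
    refine Continuous.subtype_mk ?_ _
    have h : Continuous (fun (x : ↥(PosBall Γ)) (p : Γ × Bool) => x.1 (e.symm p)) :=
      continuous_pi fun p => (continuous_apply (e.symm p)).comp continuous_subtype_val
    exact hg.comp h
  have hU : Continuous U := by
    refine Continuous.subtype_mk ?_ _
    exact continuous_pi fun a => (continuous_apply (e a)).comp
      (u_cont.comp continuous_subtype_val)
  have hGU : Function.LeftInverse G U := by
    intro x
    apply Subtype.ext
    refine Eq.trans ?_ (g_u x.1)
    funext i
    simp [G, U]
  refine ⟨Set.range U, ⟨U ∘ G, hU.comp hG, ?_, ?_⟩, ?_⟩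
  · rintro _ ⟨x, rfl⟩
    exact ⟨G x, rfl⟩
  · rintro _ ⟨x, rfl⟩
    exact congrArg U (hGU x)
  · exact ⟨(hGU.isEmbedding hG hU).toHomeomorph⟩

end
end

section
/- The following statements are equivalent: (1) for every uncountable set Γ, B(Γ) is homeomorphic to B⁺(Γ); (2) there exists an uncountable set Γ such that B(Γ) is homeomorphic to B⁺(Γ); (3) there exists a homeomorphism f : B(ℕ) → B⁺(ℕ) such that ‖f(x)‖ < ‖f(y)‖ whenever x, y ∈ B(ℕ) and ‖x‖ < ‖y‖; (4) there exists a homeomorphism f : B(ℕ) → B⁺(ℕ) such that ‖f(x)‖ = ‖x‖ for all x ∈ B(ℕ); (5) there exists a homeomorphism f : [-1,1]^ℕ → [0,1]^ℕ (in the product topologies) such that ‖f(x)‖_∞ = ‖x‖_∞ for all x ∈ [-1,1]^ℕ. -/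
open Set Filter Topology

noncomputable section

/-! ### Basic facts -/

lemma summable_of_ball {ι : Type*} {x : ι → ℝ} (hx : x ∈ Ball ι) : Summable (fun i => |x i|) :=
  summable_of_sum_le (fun _ => abs_nonneg _) hx

lemma ball_iff {ι : Type*} {x : ι → ℝ} :
    x ∈ Ball ι ↔ Summable (fun i => |x i|) ∧ ∑' i, |x i| ≤ 1 := by
  constructor
  · intro hx
    exact ⟨summable_of_ball hx, (summable_of_ball hx).tsum_le_of_sum_le hx⟩
  · rintro ⟨h1, h2⟩ s
    exact (h1.sum_le_tsum s (fun i _ => abs_nonneg _)).trans h2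

lemma tsum_le_one {ι : Type*} {x : ι → ℝ} (hx : x ∈ Ball ι) : ∑' i, |x i| ≤ 1 :=
  (ball_iff.1 hx).2

lemma abs_le_one_of_ball {ι : Type*} {x : ι → ℝ} (hx : x ∈ Ball ι) (i : ι) : |x i| ≤ 1 := by
  simpa using hx {i}

lemma zero_mem_ball (ι : Type*) : (0 : ι → ℝ) ∈ Ball ι := by
  intro s; simp

lemma isClosed_ball (ι : Type*) : IsClosed (Ball ι) := by
  have : Ball ι = ⋂ s : Finset ι, {x | ∑ i ∈ s, |x i| ≤ 1} := by
    ext x; simp [Ball]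
  rw [this]
  exact isClosed_iInter fun s => isClosed_le (by fun_prop) continuous_const

lemma isClosed_posBall (ι : Type*) : IsClosed (PosBall ι) := by
  have : PosBall ι = Ball ι ∩ ⋂ i : ι, {x | 0 ≤ x i} := by
    ext x; simp [PosBall]
  rw [this]
  exact (isClosed_ball ι).inter
    (isClosed_iInter fun s => isClosed_le continuous_const (by fun_prop))

lemma isCompact_ball (ι : Type*) : IsCompact (Ball ι) := by
  refine IsCompact.of_isClosed_subset
    (isCompact_univ_pi (fun _ : ι => isCompact_Icc (a := (-1 : ℝ)) (b := 1))) (isClosed_ball ι) ?_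
  intro x hx i _
  exact abs_le.1 (abs_le_one_of_ball hx i)

lemma isCompact_posBall (ι : Type*) : IsCompact (PosBall ι) :=
  (isCompact_ball ι).of_isClosed_subset (isClosed_posBall ι) (fun _ h => h.1)

lemma smul_mem_ball {ι : Type*} {x : ι → ℝ} (hx : x ∈ Ball ι) {c : ℝ} (h0 : 0 ≤ c) (h1 : c ≤ 1) :
    c • x ∈ Ball ι := by
  intro s
  have := hx s
  simp only [Pi.smul_apply, smul_eq_mul, abs_mul, abs_of_nonneg h0, ← Finset.mul_sum]
  have h2 : 0 ≤ ∑ i ∈ s, |x i| := Finset.sum_nonneg fun i _ => abs_nonneg _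
  nlinarith

lemma tsum_smul {ι : Type*} (x : ι → ℝ) {c : ℝ} (h0 : 0 ≤ c) :
    ∑' i, |(c • x) i| = c * ∑' i, |x i| := by
  simp only [Pi.smul_apply, smul_eq_mul, abs_mul, abs_of_nonneg h0, tsum_mul_left]

lemma continuous_coord {ι : Type*} (K : Set (ι → ℝ)) (i : ι) : Continuous fun x : K => x.1 i :=
  (continuous_apply i).comp continuous_subtype_val

/-! ### (2) implies (3) -/

lemma countable_dep {ι : Type*} {K : Set (ι → ℝ)} (hK : IsCompact K) (g : K → ℝ)
    (hg : Continuous g) :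
    ∃ C : Set ι, C.Countable ∧ ∀ x y : K, (∀ i ∈ C, x.1 i = y.1 i) → g x = g y := by
  have : CompactSpace K := isCompact_iff_compactSpace.1 hK
  have key : ∀ n : ℕ, ∃ F : Finset ι, ∀ x y : K, (∀ i ∈ F, x.1 i = y.1 i) →
      |g x - g y| < 1 / ((n : ℝ) + 1) := by
    intro n
    have hc : IsCompact {p : K × K | 1 / ((n : ℝ) + 1) ≤ |g p.1 - g p.2|} :=
      (isClosed_le continuous_const (by fun_prop)).isCompact
    obtain ⟨F, hF⟩ := hc.elim_finite_subcover (fun i : ι => {p : K × K | p.1.1 i ≠ p.2.1 i})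
      (fun i => isOpen_ne_fun ((continuous_coord K i).comp continuous_fst)
        ((continuous_coord K i).comp continuous_snd)) (by
        intro p hp
        by_contra hcon
        simp only [mem_iUnion, mem_ofPred_eq, not_exists, not_not] at hcon hp
        have : p.1 = p.2 := Subtype.ext (funext hcon)
        rw [this] at hp
        simp only [sub_self, abs_zero] at hp
        have : (0 : ℝ) < 1 / ((n : ℝ) + 1) := by positivity
        linarith)
    refine ⟨F, fun x y hxy => ?_⟩
    by_contra hcon
    have := hF (show (x, y) ∈ _ from not_lt.1 hcon)
    simp only [mem_iUnion, mem_ofPred_eq] at this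
    obtain ⟨i, hi, h⟩ := this
    exact h (hxy i hi)
  choose F hF using key
  refine ⟨⋃ n, (F n : Set ι), countable_iUnion fun n => (F n).countable_toSet, ?_⟩
  intro x y hxy
  by_contra hne
  have hpos : 0 < |g x - g y| := abs_pos.2 (sub_ne_zero.2 hne)
  obtain ⟨n, hn⟩ := exists_nat_one_div_lt hpos
  have := hF n x y (fun i hi => hxy i (mem_iUnion.2 ⟨n, hi⟩))
  linarith

/-- `A` is closed under dependence for `f` and its inverse. -/
def Good {Γ : Type} (f : ↥(Ball Γ) ≃ₜ ↥(PosBall Γ)) (A : Set Γ) : Prop :=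
  (∀ x y : ↥(Ball Γ), (∀ i ∈ A, x.1 i = y.1 i) → ∀ i ∈ A, (f x).1 i = (f y).1 i) ∧
  (∀ x y : ↥(PosBall Γ), (∀ i ∈ A, x.1 i = y.1 i) → ∀ i ∈ A, (f.symm x).1 i = (f.symm y).1 i)

lemma exists_good {Γ : Type} (f : ↥(Ball Γ) ≃ₜ ↥(PosBall Γ)) (S : Set Γ) (hS : S.Countable) :
    ∃ A : Set Γ, S ⊆ A ∧ A.Countable ∧ Good f A := by
  have h1 : ∀ i : Γ, ∃ C : Set Γ, C.Countable ∧ ∀ x y : ↥(Ball Γ), (∀ j ∈ C, x.1 j = y.1 j) →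
      (f x).1 i = (f y).1 i := fun i =>
    countable_dep (isCompact_ball Γ) (fun x => (f x).1 i)
      ((continuous_coord _ i).comp f.continuous)
  have h2 : ∀ i : Γ, ∃ C : Set Γ, C.Countable ∧ ∀ x y : ↥(PosBall Γ), (∀ j ∈ C, x.1 j = y.1 j) →
      (f.symm x).1 i = (f.symm y).1 i := fun i =>
    countable_dep (isCompact_posBall Γ) (fun x => (f.symm x).1 i)
      ((continuous_coord _ i).comp f.symm.continuous)
  choose C hC hC' using h1
  choose D hD hD' using h2
  let step : Set Γ → Set Γ := fun T => ⋃ i ∈ T, (C i ∪ D i)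
  let T : ℕ → Set Γ := fun n => step^[n] S
  have hT : ∀ n, T (n + 1) = step (T n) := fun n => Function.iterate_succ_apply' step n S
  have hTc : ∀ n, (T n).Countable := by
    intro n
    induction n with
    | zero => exact hS
    | succ n ih =>
      rw [hT]
      exact ih.biUnion fun i _ => (hC i).union (hD i)
  have hmem : ∀ i ∈ ⋃ n, T n, C i ∪ D i ⊆ ⋃ n, T n := by
    intro i hi j hj
    obtain ⟨n, hn⟩ := mem_iUnion.1 hi
    refine mem_iUnion.2 ⟨n + 1, ?_⟩
    rw [hT]
    exact mem_biUnion hn hj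
  refine ⟨⋃ n, T n, subset_iUnion T 0, countable_iUnion hTc, ?_, ?_⟩
  · intro x y hxy i hi
    exact hC' i x y fun j hj => hxy j (hmem i hi (Or.inl hj))
  · intro x y hxy i hi
    exact hD' i x y fun j hj => hxy j (hmem i hi (Or.inr hj))

lemma tsum_abs_extend {Γ : Type} {e : ℕ → Γ} (he : Function.Injective e) (u : ℕ → ℝ) :
    ∑' i, |Function.extend e u 0 i| = ∑' n, |u n| := by
  rw [← he.tsum_eq]
  · simp [he.extend_apply]
  · intro i hi
    by_contra h
    apply hi
    simp [Function.extend_apply' u (0 : Γ → ℝ) i (by simpa using h)]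

lemma summable_abs_extend {Γ : Type} {e : ℕ → Γ} (he : Function.Injective e) {u : ℕ → ℝ}
    (hu : Summable fun n => |u n|) : Summable fun i => |Function.extend e u 0 i| := by
  rw [← he.summable_iff]
  · simpa [Function.comp_def, he.extend_apply] using hu
  · intro i hi
    simp [Function.extend_apply' u (0 : Γ → ℝ) i (by simpa using hi)]

lemma extend_mem_ball {Γ : Type} {e : ℕ → Γ} (he : Function.Injective e) {u : ℕ → ℝ}
    (hu : u ∈ Ball ℕ) : Function.extend e u 0 ∈ Ball Γ := by
  rw [ball_iff] at hu ⊢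
  exact ⟨summable_abs_extend he hu.1, by rw [tsum_abs_extend he]; exact hu.2⟩

lemma extend_zero_on {Γ : Type} {e : ℕ → Γ} {A : Set Γ} (hd : ∀ n, e n ∉ A) (u : ℕ → ℝ)
    {i : Γ} (hi : i ∈ A) : Function.extend e u 0 i = 0 := by
  rw [Function.extend_apply' u (0 : Γ → ℝ) i (by rintro ⟨n, rfl⟩; exact hd n hi)]
  rfl

lemma abs_indicator' {Γ : Type} (A : Set Γ) (x : Γ → ℝ) (i : Γ) :
    |A.indicator x i| = A.indicator (fun i => |x i|) i := by
  by_cases h : i ∈ A <;> simp [h]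

lemma summable_indicator {Γ : Type} (A : Set Γ) {x : Γ → ℝ} (hx : Summable fun i => |x i|) :
    Summable fun i => |A.indicator x i| := by
  simp only [abs_indicator']
  exact hx.indicator A

lemma split_le {Γ : Type} {e : ℕ → Γ} (he : Function.Injective e) {A : Set Γ}
    (hd : ∀ n, e n ∉ A) {x : Γ → ℝ} (hx : x ∈ Ball Γ) :
    Summable (fun n => |x (e n)|) ∧ ∑' i, |A.indicator x i| + ∑' n, |x (e n)| ≤ 1 := by
  obtain ⟨hs, h1⟩ := ball_iff.1 hx
  have hs' : Summable (fun n => |x (e n)|) := hs.comp_injective he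
  refine ⟨hs', ?_⟩
  rw [← tsum_abs_extend he (fun n => x (e n)),
    ← (summable_indicator A hs).tsum_add (summable_abs_extend he hs')]
  refine le_trans (Summable.tsum_le_tsum ?_ ((summable_indicator A hs).add
    (summable_abs_extend he hs')) hs) h1
  intro i
  by_cases hi : i ∈ A
  · rw [extend_zero_on hd _ hi]; simp [hi]
  · by_cases hr : ∃ n, e n = i
    · obtain ⟨n, rfl⟩ := hr
      rw [he.extend_apply]
      simp [hi]
    · rw [Function.extend_apply' _ _ _ hr]
      simp [hi]

lemma glue_apply_A {Γ : Type} {e : ℕ → Γ} {A : Set Γ}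
    (hd : ∀ n, e n ∉ A) (z : Γ → ℝ) (v : ℕ → ℝ) {i : Γ} (hi : i ∈ A) :
    (A.indicator z + Function.extend e v 0) i = z i := by
  simp [hi, extend_zero_on hd v hi]

lemma glue_apply_e {Γ : Type} {e : ℕ → Γ} (he : Function.Injective e) {A : Set Γ}
    (hd : ∀ n, e n ∉ A) (z : Γ → ℝ) (v : ℕ → ℝ) (n : ℕ) :
    (A.indicator z + Function.extend e v 0) (e n) = v n := by
  simp [hd, he.extend_apply]

lemma glue_mem {Γ : Type} {e : ℕ → Γ} (he : Function.Injective e) {A : Set Γ}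
    {z : Γ → ℝ} {v : ℕ → ℝ} (hz : Summable fun i => |z i|)
    (hv : Summable fun n => |v n|)
    (hle : ∑' i, |A.indicator z i| + ∑' n, |v n| ≤ 1) :
    A.indicator z + Function.extend e v 0 ∈ Ball Γ := by
  rw [ball_iff]
  have h1 := (summable_indicator A hz).add (summable_abs_extend he hv)
  have h2 : ∀ i, |(A.indicator z + Function.extend e v 0) i| ≤
      |A.indicator z i| + |Function.extend e v 0 i| := fun i => abs_add_le _ _
  have h3 : Summable fun i => |(A.indicator z + Function.extend e v 0) i| :=
    Summable.of_nonneg_of_le (fun i => abs_nonneg _) h2 h1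
  refine ⟨h3, (Summable.tsum_le_tsum h2 h3 h1).trans ?_⟩
  rw [(summable_indicator A hz).tsum_add (summable_abs_extend he hv), tsum_abs_extend he]
  exact hle

lemma extend_nonneg {Γ : Type} (e : ℕ → Γ) {v : ℕ → ℝ} (hv : ∀ n, 0 ≤ v n) (i : Γ) :
    0 ≤ Function.extend e v 0 i := by
  classical
  rw [Function.extend_def]
  split_ifs
  · exact hv _
  · exact le_rfl

lemma glue_nonneg {Γ : Type} (e : ℕ → Γ) (A : Set Γ) {z : Γ → ℝ} {v : ℕ → ℝ}
    (hz : ∀ i, 0 ≤ z i) (hv : ∀ n, 0 ≤ v n) (i : Γ) :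
    0 ≤ (A.indicator z + Function.extend e v 0) i :=
  add_nonneg (indicator_nonneg (fun i _ => hz i) i) (extend_nonneg e hv i)

lemma continuous_extend {Γ : Type} (e : ℕ → Γ) (i : Γ) :
    Continuous fun v : ℕ → ℝ => Function.extend e v 0 i := by
  classical
  simp only [Function.extend_def]
  split_ifs
  · fun_prop
  · exact continuous_const

lemma core23 {Γ : Type} (f : ↥(Ball Γ) ≃ₜ ↥(PosBall Γ)) (A : Set Γ) (e : ℕ → Γ)
    (he : Function.Injective e) (hd : ∀ n, e n ∉ A) (hA : Good f A) (hA' : Good f (A ∪ range e))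
    (a : ℕ → Γ) (ha : Function.Injective a) (haA : ∀ n, a n ∈ A) :
    ∃ f : ↥(Ball ℕ) ≃ₜ ↥(PosBall ℕ), ∀ x y : ↥(Ball ℕ),
          (∑' n, |x.1 n|) < (∑' n, |y.1 n|) → (∑' n, |(f x).1 n|) < (∑' n, |(f y).1 n|) := by
  classical
  set y0 : Γ → ℝ := (f ⟨0, zero_mem_ball Γ⟩).1 with hy0
  have hy0s : Summable fun i => |y0 i| := summable_of_ball (f ⟨0, zero_mem_ball Γ⟩).2.1
  have hy0n : ∀ i, 0 ≤ y0 i := (f ⟨0, zero_mem_ball Γ⟩).2.2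
  set m : ℝ := ∑' i, |A.indicator y0 i| with hm
  let E : ↥(Ball ℕ) → ↥(Ball Γ) := fun u => ⟨Function.extend e u.1 0, extend_mem_ball he u.2⟩
  have hEA : ∀ u, ∀ i ∈ A, (E u).1 i = 0 := fun u i hi => extend_zero_on hd u.1 hi
  have hEe : ∀ u n, (E u).1 (e n) = u.1 n := fun u n => he.extend_apply _ _ _
  have hEc : Continuous E := by
    refine Continuous.subtype_mk (continuous_pi fun i => ?_) _
    exact (continuous_extend e i).comp continuous_subtype_val
  have hfA : ∀ u, ∀ i ∈ A, (f (E u)).1 i = y0 i := by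
    intro u i hi
    exact hA.1 (E u) ⟨0, zero_mem_ball Γ⟩ (fun j hj => hEA u j hj) i hi
  have hfind : ∀ u, A.indicator (f (E u)).1 = A.indicator y0 := by
    intro u
    exact indicator_congr (fun i hi => hfA u i hi)
  have hfsum : ∀ u, Summable (fun n => |(f (E u)).1 (e n)|) ∧
      m + ∑' n, |(f (E u)).1 (e n)| ≤ 1 := by
    intro u
    have := split_le he hd (f (E u)).2.1
    rw [hfind] at this
    exact this
  have hsingle : Pi.single 0 1 ∈ Ball ℕ := by
    rw [ball_iff]
    have : (fun i => |(Pi.single 0 1 : ℕ → ℝ) i|) = Pi.single 0 1 := by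
      ext i
      rcases eq_or_ne i 0 with rfl | h
      · simp
      · simp [h]
    rw [this]
    exact ⟨(hasSum_pi_single 0 1).summable, by rw [tsum_pi_single]⟩
  have hm1 : m < 1 := by
    by_contra hcon
    have hz : ∀ u n, (f (E u)).1 (e n) = 0 := by
      intro u n
      have h1 := (hfsum u).2
      have h2 := (hfsum u).1.le_tsum n (fun _ _ => abs_nonneg _)
      have h3 := abs_nonneg ((f (E u)).1 (e n))
      exact abs_eq_zero.1 (by linarith)
    have h := hA'.2 (f (E ⟨0, zero_mem_ball ℕ⟩)) (f (E ⟨_, hsingle⟩)) (by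
      rintro i (hi | ⟨n, rfl⟩)
      · rw [hfA _ i hi, hfA _ i hi]
      · rw [hz, hz]) (e 0) (Or.inr ⟨0, rfl⟩)
    simp [hEe] at h
  have hm1' : 0 < 1 - m := by linarith
  have hgm : ∀ u, (1 - m)⁻¹ • (fun n => (f (E u)).1 (e n)) ∈ PosBall ℕ := by
    intro u
    refine ⟨ball_iff.2 ⟨?_, ?_⟩, fun n => ?_⟩
    · simpa [abs_mul] using (hfsum u).1.mul_left |(1 - m)⁻¹|
    · rw [tsum_smul _ (by positivity), inv_mul_le_iff₀ hm1']
      linarith [(hfsum u).2]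
    · exact mul_nonneg (by positivity) ((f (E u)).2.2 _)
  have hzs : ∀ v : ↥(PosBall ℕ), Summable fun n => |((1 - m) • v.1) n| := by
    intro v
    simpa [abs_mul] using (summable_of_ball v.2.1).mul_left |1 - m|
  have hzm : ∀ v : ↥(PosBall ℕ), A.indicator y0 + Function.extend e ((1 - m) • v.1) 0 ∈
      PosBall Γ := by
    intro v
    refine ⟨glue_mem he hy0s (hzs v) ?_, glue_nonneg e A hy0n fun n => ?_⟩
    · rw [tsum_smul _ hm1'.le, ← hm]
      nlinarith [tsum_le_one v.2.1]
    · exact mul_nonneg hm1'.le (v.2.2 n)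
  let Z : ↥(PosBall ℕ) → ↥(PosBall Γ) := fun v => ⟨_, hzm v⟩
  have hZA : ∀ v, ∀ i ∈ A, (Z v).1 i = y0 i := fun v i hi => glue_apply_A hd y0 _ hi
  have hZe : ∀ v n, (Z v).1 (e n) = (1 - m) * v.1 n := fun v n => glue_apply_e he hd y0 _ n
  have hZc : Continuous Z := by
    refine Continuous.subtype_mk (continuous_pi fun i => ?_) _
    have h1 : Continuous fun v : ↥(PosBall ℕ) => (1 - m) • v.1 :=
      continuous_pi fun n => continuous_const.mul (continuous_coord _ n)
    exact continuous_const.add ((continuous_extend e i).comp h1)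
  have hsA : ∀ v, ∀ i ∈ A, (f.symm (Z v)).1 i = 0 := by
    intro v i hi
    have := hA.2 (Z v) (f ⟨0, zero_mem_ball Γ⟩) (fun j hj => hZA v j hj) i hi
    rw [this]; simp
  let g : ↥(Ball ℕ) ≃ₜ ↥(PosBall ℕ) :=
    { toFun := fun u => ⟨_, hgm u⟩
      invFun := fun v => ⟨fun n => (f.symm (Z v)).1 (e n),
        ball_iff.2 ⟨(split_le he hd (f.symm (Z v)).2).1, by
          have h1 := (split_le he hd (f.symm (Z v)).2).2
          have h2 : 0 ≤ ∑' i, |A.indicator (f.symm (Z v)).1 i| := tsum_nonneg fun _ => abs_nonneg _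
          linarith⟩⟩
      left_inv := by
        intro u
        apply Subtype.ext
        funext n
        have := hA'.2 (Z ⟨_, hgm u⟩) (f (E u)) (by
          rintro i (hi | ⟨n, rfl⟩)
          · rw [hZA _ i hi, hfA _ i hi]
          · rw [hZe]
            simp only [Pi.smul_apply, smul_eq_mul]
            field_simp) (e n) (Or.inr ⟨n, rfl⟩)
        simp only
        rw [this, f.symm_apply_apply, hEe]
      right_inv := by
        intro v
        apply Subtype.ext
        funext n
        simp only [Pi.smul_apply, smul_eq_mul]
        rw [inv_mul_eq_iff_eq_mul₀ hm1'.ne', ← hZe]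
        have := hA'.1 (E ⟨fun n => (f.symm (Z v)).1 (e n), ball_iff.2
          ⟨(split_le he hd (f.symm (Z v)).2).1, by
          have h1 := (split_le he hd (f.symm (Z v)).2).2
          have h2 : 0 ≤ ∑' i, |A.indicator (f.symm (Z v)).1 i| := tsum_nonneg fun _ => abs_nonneg _
          linarith⟩⟩) (f.symm (Z v)) (by
          rintro i (hi | ⟨n, rfl⟩)
          · rw [hEA _ i hi, hsA _ i hi]
          · rw [hEe]) (e n) (Or.inr ⟨n, rfl⟩)
        rw [this, f.apply_symm_apply]
      continuous_toFun := by
        refine Continuous.subtype_mk (continuous_pi fun n => ?_) _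
        exact continuous_const.mul ((continuous_coord _ (e n)).comp (f.continuous.comp hEc))
      continuous_invFun := by
        refine Continuous.subtype_mk (continuous_pi fun n => ?_) _
        exact (continuous_coord _ (e n)).comp (f.symm.continuous.comp hZc) }
  have hg : ∀ u n, (f (E u)).1 (e n) = (1 - m) * (g u).1 n := by
    intro u n
    change _ = (1 - m) * ((1 - m)⁻¹ * _)
    field_simp
  refine ⟨g, fun u u' hlt => ?_⟩
  by_contra hcon
  rw [not_lt] at hcon
  -- a finite set witnessing the norm of `u'`
  obtain ⟨F, hF⟩ : ∃ F : Finset ℕ, ∑' n, |u.1 n| < ∑ n ∈ F, |u'.1 n| :=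
    ((summable_of_ball u'.2).hasSum.eventually (lt_mem_nhds hlt)).exists
  let U : Set ↥(PosBall Γ) := {z | ∑' n, |u.1 n| < ∑ n ∈ F, |(f.symm z).1 (e n)|}
  have hU : IsOpen U := by
    refine isOpen_lt continuous_const (continuous_finsetSum _ fun n _ => ?_)
    exact ((continuous_coord _ (e n)).comp f.symm.continuous).abs
  obtain ⟨O, hO, hOU⟩ := isOpen_induced_iff.1 hU
  have hUO : ∀ z : ↥(PosBall Γ), z.1 ∈ O ↔ z ∈ U := fun z => by rw [← hOU]; rfl
  have hw' : (Z (g u')).1 ∈ O := by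
    rw [hUO]
    change _ < ∑ n ∈ F, |(g.symm (g u')).1 n|
    rw [g.symm_apply_apply]
    exact hF
  -- shrink a bit
  let w : ℝ → Γ → ℝ := fun c => A.indicator y0 + Function.extend e (c • ((1 - m) • (g u').1)) 0
  have hwc : Continuous w := by
    refine continuous_pi fun i => continuous_const.add ((continuous_extend e i).comp ?_)
    fun_prop
  have hw1 : w 1 ∈ O := by
    have : w 1 = (Z (g u')).1 := by simp [w, Z]
    rw [this]; exact hw'
  obtain ⟨c, hc0, hc1, hcO⟩ : ∃ c : ℝ, 0 ≤ c ∧ c < 1 ∧ w c ∈ O := by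
    have h1 : ∀ᶠ c in 𝓝[<] (1 : ℝ), w c ∈ O :=
      (hwc.continuousAt.eventually (hO.mem_nhds hw1)).filter_mono nhdsWithin_le_nhds
    have h2 : ∀ᶠ c in 𝓝[<] (1 : ℝ), 0 ≤ c :=
      (lt_mem_nhds one_pos |> fun h => (show ∀ᶠ c in 𝓝 (1 : ℝ), (0 : ℝ) ≤ c from
        Filter.Eventually.mono h fun _ h => le_of_lt h)).filter_mono nhdsWithin_le_nhds
    obtain ⟨c, hc⟩ := ((h1.and h2).and self_mem_nhdsWithin).exists
    exact ⟨c, hc.1.2, hc.2, hc.1.1⟩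
  -- the sequence
  have hxm : ∀ k, (E u).1 + Pi.single (a k) (1 - ∑' n, |u.1 n|) ∈ Ball Γ := by
    intro k
    have h1 := summable_of_ball (E u).2
    have hr : 0 ≤ 1 - ∑' n, |u.1 n| := sub_nonneg.2 (tsum_le_one u.2)
    have h0 : ∀ i, |(Pi.single (a k) (1 - ∑' n, |u.1 n|) : Γ → ℝ) i| =
        (Pi.single (a k) (1 - ∑' n, |u.1 n|) : Γ → ℝ) i := by
      intro i
      apply abs_of_nonneg
      rw [Pi.single_apply]
      split_ifs
      · exact hr
      · exact le_rfl
    have h2 : ∀ i, |((E u).1 + Pi.single (a k) (1 - ∑' n, |u.1 n|) : Γ → ℝ) i| ≤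
        |(E u).1 i| + (Pi.single (a k) (1 - ∑' n, |u.1 n|) : Γ → ℝ) i := by
      intro i
      rw [← h0]
      exact abs_add_le _ _
    have h3 := h1.hasSum.add (hasSum_pi_single (a k) (1 - ∑' n, |u.1 n|))
    have h4 := Summable.of_nonneg_of_le (fun i => abs_nonneg _) h2 h3.summable
    refine ball_iff.2 ⟨h4, (h4.tsum_le_tsum h2 h3.summable).trans ?_⟩
    rw [h3.tsum_eq]
    have h5 : ∑' i, |(E u).1 i| = ∑' n, |u.1 n| := tsum_abs_extend he u.1
    linarith
  let x : ℕ → ↥(Ball Γ) := fun k => ⟨_, hxm k⟩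
  have hx : Tendsto x atTop (𝓝 (E u)) := by
    rw [tendsto_subtype_rng, tendsto_pi_nhds]
    intro i
    refine tendsto_const_nhds.congr' ?_
    have : ∀ᶠ k in atTop, a k ≠ i := by
      have := ha.tendsto_cofinite.eventually (show ∀ᶠ j in cofinite, j ≠ i by simp)
      rwa [Nat.cofinite_eq_atTop] at this
    filter_upwards [this] with k hk
    simp [x, hk.symm]
  have hfx : Tendsto (fun k => f (x k)) atTop (𝓝 (f (E u))) := (f.continuous.tendsto _).comp hx
  have hfxi : ∀ i, Tendsto (fun k => (f (x k)).1 i) atTop (𝓝 ((f (E u)).1 i)) := fun i =>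
    ((continuous_coord _ i).tendsto _).comp hfx
  let z : ℕ → Γ → ℝ := fun k =>
    A.indicator (f (x k)).1 + Function.extend e (c • ((1 - m) • (g u').1)) 0
  have hzO : ∀ᶠ k in atTop, z k ∈ O := by
    have : Tendsto z atTop (𝓝 (w c)) := by
      rw [tendsto_pi_nhds]
      intro i
      refine Tendsto.add_const _ ?_
      by_cases hi : i ∈ A
      · simp only [hi, indicator_of_mem]
        rw [← hfA u i hi]
        exact hfxi i
      · simp [hi]
    exact this.eventually (hO.mem_nhds hcO)
  have hcs : Summable fun n => |(c • ((1 - m) • (g u').1)) n| := by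
    simpa [abs_mul] using ((summable_of_ball (g u').2.1).mul_left |1 - m|).mul_left |c|
  have hzP : ∀ᶠ k in atTop, z k ∈ PosBall Γ := by
    have key : ∀ᶠ k in atTop, c * ((1 - m) * ∑' n, |(g u').1 n|) ≤ ∑' n, |(f (x k)).1 (e n)| := by
      have hnn : 0 ≤ ∑' n, |(g u').1 n| := tsum_nonneg fun _ => abs_nonneg _
      rcases (mul_nonneg hc0 (mul_nonneg hm1'.le hnn)).eq_or_lt with h0 | h0
      · rw [← h0]
        exact Eventually.of_forall fun k => tsum_nonneg fun _ => abs_nonneg _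
      · have hlt2 : c * ((1 - m) * ∑' n, |(g u').1 n|) < ∑' n, |(f (E u)).1 (e n)| := by
          have : ∑' n, |(f (E u)).1 (e n)| = (1 - m) * ∑' n, |(g u).1 n| := by
            simp only [hg, abs_mul, abs_of_pos hm1', tsum_mul_left]
          rw [this]
          have h5 : 0 < (1 - m) * ∑' n, |(g u').1 n| := by
            by_contra hh
            nlinarith
          nlinarith
        obtain ⟨F', hF'⟩ : ∃ F' : Finset ℕ, c * ((1 - m) * ∑' n, |(g u').1 n|) <
            ∑ n ∈ F', |(f (E u)).1 (e n)| :=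
          ((hfsum u).1.hasSum.eventually (lt_mem_nhds hlt2)).exists
        have ht : Tendsto (fun k => ∑ n ∈ F', |(f (x k)).1 (e n)|) atTop
            (𝓝 (∑ n ∈ F', |(f (E u)).1 (e n)|)) :=
          tendsto_finsetSum _ fun n _ => (hfxi (e n)).abs
        filter_upwards [ht.eventually (lt_mem_nhds hF')] with k hk
        exact hk.le.trans ((split_le he hd (f (x k)).2.1).1.sum_le_tsum F'
          fun _ _ => abs_nonneg _)
    filter_upwards [key] with k hk
    refine ⟨glue_mem he (summable_of_ball (f (x k)).2.1) hcs ?_,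
      glue_nonneg e A (f (x k)).2.2 fun n =>
        mul_nonneg hc0 (mul_nonneg hm1'.le ((g u').2.2 n))⟩
    rw [tsum_smul _ hc0, tsum_smul _ hm1'.le]
    linarith [(split_le he hd (f (x k)).2.1).2]
  obtain ⟨k, hkO, hkP⟩ := (hzO.and hzP).exists
  have hkU : ∑' n, |u.1 n| < ∑ n ∈ F, |(f.symm ⟨z k, hkP⟩).1 (e n)| := (hUO ⟨z k, hkP⟩).1 hkO
  have hAz : ∀ i ∈ A, (f.symm ⟨z k, hkP⟩).1 i = (x k).1 i := by
    intro i hi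
    have := hA.2 ⟨z k, hkP⟩ (f (x k)) (fun j hj => glue_apply_A hd _ _ hj) i hi
    rw [this, f.symm_apply_apply]
  have hsp := split_le he hd (f.symm ⟨z k, hkP⟩).2
  have h1 := hsp.1.sum_le_tsum F fun _ _ => abs_nonneg _
  have h2 := (summable_indicator A (summable_of_ball (f.symm ⟨z k, hkP⟩).2)).le_tsum (a k)
    fun _ _ => abs_nonneg _
  have h3 : |A.indicator (f.symm ⟨z k, hkP⟩).1 (a k)| = abs (1 - ∑' n, |u.1 n|) := by
    rw [indicator_of_mem (haA k), hAz _ (haA k)]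
    simp only [x, Pi.add_apply, hEA u _ (haA k), Pi.single_eq_same, zero_add]
  have h4 := le_abs_self (1 - ∑' n, |u.1 n|)
  linarith [hsp.2]

lemma imp23 (h : ∃ Γ : Type, Uncountable Γ ∧ Nonempty (↥(Ball Γ) ≃ₜ ↥(PosBall Γ))) :
    ∃ f : ↥(Ball ℕ) ≃ₜ ↥(PosBall ℕ), ∀ x y : ↥(Ball ℕ),
          (∑' n, |x.1 n|) < (∑' n, |y.1 n|) → (∑' n, |(f x).1 n|) < (∑' n, |(f y).1 n|) := by
  obtain ⟨Γ, hΓ, ⟨f⟩⟩ := h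
  let b : ℕ ↪ Γ := Infinite.natEmbedding Γ
  obtain ⟨A, hbA, hAc, hA⟩ := exists_good f (range b) (countable_range b)
  have hAi : (Aᶜ).Infinite := by
    intro hfin
    have : (univ : Set Γ).Countable := by
      rw [← union_compl_self A]; exact hAc.union hfin.countable
    exact not_countable (countable_univ_iff.1 this)
  have := hAi.to_subtype
  let d : ℕ ↪ ↥(Aᶜ) := Infinite.natEmbedding _
  obtain ⟨A', hdA, hAc', hA'⟩ := exists_good f (A ∪ range fun n => (d n : Γ))
    (hAc.union (countable_range _))
  have hWi : (A' \ A).Infinite := by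
    refine (infinite_range_of_injective (f := fun n => (d n : Γ))
      (Subtype.val_injective.comp d.injective)).mono ?_
    rintro _ ⟨n, rfl⟩
    exact ⟨hdA (Or.inr ⟨n, rfl⟩), (d n).2⟩
  have h1 := hWi.to_subtype
  have h2 := (hAc'.mono (sdiff_subset (t := A))).to_subtype
  obtain ⟨q⟩ : Nonempty (ℕ ≃ ↥(A' \ A)) := nonempty_equiv_of_countable
  have hr : A ∪ range (fun n => (q n : Γ)) = A' := by
    have : range (fun n => (q n : Γ)) = A' \ A := by
      have := q.surjective.range_comp (fun i : ↥(A' \ A) => (i : Γ))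
      rw [Subtype.range_coe] at this
      exact this
    rw [this, union_sdiff_cancel (subset_union_left.trans hdA)]
  exact core23 f A (fun n => q n) (Subtype.val_injective.comp q.injective) (fun n => (q n).2.2) hA
    (by rw [hr]; exact hA') b b.injective (fun n => hbA ⟨n, rfl⟩)

/-! ### (3) implies (4) -/

/-- Partial sums. -/
def psum (y : ℕ → ℝ) (n : ℕ) : ℝ := ∑ i ∈ Finset.range n, y i

lemma psum_mem {y : ℕ → ℝ} (hy : y ∈ PosBall ℕ) (n : ℕ) : psum y n ∈ Icc (0 : ℝ) 1 := by
  refine ⟨Finset.sum_nonneg fun i _ => hy.2 i, ?_⟩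
  have := hy.1 (Finset.range n)
  simp only [abs_of_nonneg (hy.2 _)] at this
  exact this

lemma psum_succ (y : ℕ → ℝ) (n : ℕ) : psum y (n + 1) = psum y n + y n :=
  Finset.sum_range_succ _ _

/-- Reparametrize the partial sums. -/
def rep (ψ : Icc (0 : ℝ) 1 ≃o Icc (0 : ℝ) 1) (y : ↥(PosBall ℕ)) : ℕ → ℝ := fun n =>
  (ψ ⟨psum y.1 (n + 1), psum_mem y.2 _⟩ : ℝ) - ψ ⟨psum y.1 n, psum_mem y.2 _⟩

lemma psum_rep (ψ : Icc (0 : ℝ) 1 ≃o Icc (0 : ℝ) 1) (y : ↥(PosBall ℕ)) (n : ℕ) :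
    psum (rep ψ y) n = ψ ⟨psum y.1 n, psum_mem y.2 _⟩ := by
  induction n with
  | zero =>
    have h1 : (⟨psum y.1 0, psum_mem y.2 _⟩ : Icc (0 : ℝ) 1) = ⊥ := by
      apply Subtype.ext; simp [psum]
    rw [h1, ψ.map_bot]
    simp [psum]
  | succ n ih =>
    rw [psum_succ, ih]
    simp [rep]

lemma rep_nonneg (ψ : Icc (0 : ℝ) 1 ≃o Icc (0 : ℝ) 1) (y : ↥(PosBall ℕ)) (n : ℕ) :
    0 ≤ rep ψ y n := by
  refine sub_nonneg.2 (ψ.monotone ?_)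
  rw [Subtype.mk_le_mk, psum_succ]
  linarith [y.2.2 n]

lemma mem_posBall_of_psum {y : ℕ → ℝ} (h0 : ∀ n, 0 ≤ y n) (h : ∀ n, psum y n ≤ 1) :
    y ∈ PosBall ℕ := by
  refine ⟨fun s => ?_, h0⟩
  obtain ⟨n, hn⟩ := s.exists_nat_subset_range
  simp only [abs_of_nonneg (h0 _)]
  exact (Finset.sum_le_sum_of_subset_of_nonneg hn fun i _ _ => h0 i).trans (h n)

lemma rep_mem (ψ : Icc (0 : ℝ) 1 ≃o Icc (0 : ℝ) 1) (y : ↥(PosBall ℕ)) : rep ψ y ∈ PosBall ℕ :=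
  mem_posBall_of_psum (rep_nonneg ψ y) fun n => by rw [psum_rep]; exact (ψ _).2.2

lemma eq_of_psum {x y : ℕ → ℝ} (h : ∀ n, psum x n = psum y n) : x = y := by
  funext n
  have h1 := h (n + 1)
  rw [psum_succ, psum_succ, h n] at h1
  linarith

lemma rep_rep (ψ φ : Icc (0 : ℝ) 1 ≃o Icc (0 : ℝ) 1) (h : ∀ t, φ (ψ t) = t) (y : ↥(PosBall ℕ)) :
    rep φ ⟨rep ψ y, rep_mem ψ y⟩ = y.1 := by
  apply eq_of_psum
  intro n
  rw [psum_rep]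
  have : (⟨psum (rep ψ y) n, psum_mem (rep_mem ψ y) n⟩ : Icc (0 : ℝ) 1) =
      ψ ⟨psum y.1 n, psum_mem y.2 _⟩ := Subtype.ext (psum_rep ψ y n)
  rw [this, h]

lemma continuous_rep (ψ : Icc (0 : ℝ) 1 ≃o Icc (0 : ℝ) 1) : Continuous (rep ψ) := by
  have h1 : ∀ n, Continuous fun y : ↥(PosBall ℕ) => psum y.1 n := fun n =>
    continuous_finsetSum _ fun i _ => continuous_coord _ i
  have h2 : ∀ n, Continuous fun y : ↥(PosBall ℕ) =>
      (ψ ⟨psum y.1 n, psum_mem y.2 n⟩ : ℝ) := fun n =>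
    continuous_subtype_val.comp (ψ.continuous.comp ((h1 n).subtype_mk _))
  exact continuous_pi fun n => (h2 (n + 1)).sub (h2 n)

/-- Reparametrization as a homeomorphism. -/
def repHomeo (ψ : Icc (0 : ℝ) 1 ≃o Icc (0 : ℝ) 1) : ↥(PosBall ℕ) ≃ₜ ↥(PosBall ℕ) where
  toFun y := ⟨rep ψ y, rep_mem ψ y⟩
  invFun y := ⟨rep ψ.symm y, rep_mem ψ.symm y⟩
  left_inv y := Subtype.ext (rep_rep ψ ψ.symm (fun t => ψ.symm_apply_apply t) y)
  right_inv y := Subtype.ext (rep_rep ψ.symm ψ (fun t => ψ.apply_symm_apply t) y)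
  continuous_toFun := (continuous_rep ψ).subtype_mk _
  continuous_invFun := (continuous_rep ψ.symm).subtype_mk _

lemma tsum_abs_mem {ι : Type*} {x : ι → ℝ} (hx : x ∈ Ball ι) : ∑' n, |x n| ∈ Icc (0 : ℝ) 1 :=
  ⟨tsum_nonneg fun _ => abs_nonneg _, tsum_le_one hx⟩

lemma tendsto_psum (y : ↥(PosBall ℕ)) :
    Tendsto (fun n => psum y.1 n) atTop (𝓝 (∑' n, |y.1 n|)) := by
  have := (summable_of_ball y.2.1).hasSum.tendsto_sum_nat
  simp only [abs_of_nonneg (y.2.2 _)] at this ⊢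
  exact this

lemma tsum_repHomeo (ψ : Icc (0 : ℝ) 1 ≃o Icc (0 : ℝ) 1) (y : ↥(PosBall ℕ)) :
    ∑' n, |(repHomeo ψ y).1 n| = ψ ⟨∑' n, |y.1 n|, tsum_abs_mem y.2.1⟩ := by
  have h1 := tendsto_psum (repHomeo ψ y)
  have h2 : Tendsto (fun n => (ψ ⟨psum y.1 n, psum_mem y.2 n⟩ : ℝ)) atTop
      (𝓝 (ψ ⟨∑' n, |y.1 n|, tsum_abs_mem y.2.1⟩ : ℝ)) := by
    refine ((continuous_subtype_val.comp ψ.continuous).tendsto _).comp ?_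
    rw [tendsto_subtype_rng]
    exact tendsto_psum y
  refine tendsto_nhds_unique h1 (h2.congr fun n => ?_)
  exact (psum_rep ψ y n).symm

lemma isClosed_tsum_le {K : Set (ℕ → ℝ)} (hK : K ⊆ Ball ℕ) (c : ℝ) :
    IsClosed {z : K | ∑' n, |z.1 n| ≤ c} := by
  have : {z : K | ∑' n, |z.1 n| ≤ c} = ⋂ s : Finset ℕ, {z : K | ∑ i ∈ s, |z.1 i| ≤ c} := by
    ext z
    simp only [mem_iInter, mem_ofPred_eq]
    constructor
    · intro h s
      exact ((summable_of_ball (hK z.2)).sum_le_tsum s fun _ _ => abs_nonneg _).trans h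
    · intro h
      exact (summable_of_ball (hK z.2)).tsum_le_of_sum_le h
  rw [this]
  exact isClosed_iInter fun s => isClosed_le
    (continuous_finsetSum _ fun i _ => (continuous_coord _ i).abs) continuous_const

lemma eq_zero_of_tsum {x : ℕ → ℝ} (hx : x ∈ Ball ℕ) (h : ∑' n, |x n| = 0) : x = 0 := by
  funext n
  have := (summable_of_ball hx).le_tsum n fun _ _ => abs_nonneg _
  exact abs_eq_zero.1 (le_antisymm (this.trans h.le) (abs_nonneg _))

lemma norm_eq_aux (f : ↥(Ball ℕ) ≃ₜ ↥(PosBall ℕ))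
    (hf : ∀ x y : ↥(Ball ℕ),
      (∑' n, |x.1 n|) < (∑' n, |y.1 n|) → (∑' n, |(f x).1 n|) < (∑' n, |(f y).1 n|))
    (x y : ↥(Ball ℕ)) (h : ∑' n, |x.1 n| = ∑' n, |y.1 n|) :
    ∑' n, |(f y).1 n| ≤ ∑' n, |(f x).1 n| := by
  rcases (tsum_abs_mem y.2).1.eq_or_lt with h0 | h0
  · have hy := eq_zero_of_tsum y.2 h0.symm
    have hx := eq_zero_of_tsum x.2 (h.trans h0.symm)
    have : x = y := Subtype.ext (hx.trans hy.symm)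
    rw [this]
  · let c : ℕ → ℝ := fun k => 1 - 1 / ((k : ℝ) + 1)
    have hc0 : ∀ k, 0 ≤ c k := fun k => by
      simp only [c, sub_nonneg]
      rw [div_le_one (by positivity)]
      linarith [(Nat.cast_nonneg k : (0 : ℝ) ≤ k)]
    have hc1 : ∀ k, c k < 1 := fun k => by
      have : (0 : ℝ) < 1 / ((k : ℝ) + 1) := by positivity
      simp only [c]; linarith
    have hct : Tendsto c atTop (𝓝 1) := by
      simpa [c] using tendsto_one_div_add_atTop_nhds_zero_nat (𝕜 := ℝ) |>.const_sub 1
    let z : ℕ → ↥(Ball ℕ) := fun k => ⟨c k • y.1, smul_mem_ball y.2 (hc0 k) (hc1 k).le⟩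
    have hz : Tendsto z atTop (𝓝 y) := by
      rw [tendsto_subtype_rng]
      have := hct.smul_const y.1
      rwa [one_smul] at this
    refine (isClosed_tsum_le (K := PosBall ℕ) (fun _ h => h.1) (∑' n, |(f x).1 n|)).mem_of_tendsto
      ((f.continuous.tendsto y).comp hz) (Eventually.of_forall fun k => ?_)
    refine (hf (z k) x ?_).le
    change ∑' n, |(c k • y.1) n| < _
    rw [tsum_smul _ (hc0 k), h]
    nlinarith [hc1 k]

lemma single_mem {t : ℝ} (ht : t ∈ Icc (0 : ℝ) 1) :
    (Pi.single 0 t : ℕ → ℝ) ∈ PosBall ℕ ∧ ∑' n, |(Pi.single 0 t : ℕ → ℝ) n| = t := by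
  have h0 : ∀ n, 0 ≤ (Pi.single 0 t : ℕ → ℝ) n := by
    intro n
    rw [Pi.single_apply]
    split_ifs
    · exact ht.1
    · exact le_rfl
  have h1 : ∑' n, |(Pi.single 0 t : ℕ → ℝ) n| = t := by
    simp only [abs_of_nonneg (h0 _)]
    exact (hasSum_pi_single 0 t).tsum_eq
  refine ⟨⟨ball_iff.2 ⟨?_, ?_⟩, h0⟩, h1⟩
  · simp only [abs_of_nonneg (h0 _)]
    exact (hasSum_pi_single 0 t).summable
  · rw [h1]; exact ht.2

lemma imp34 (h : ∃ f : ↥(Ball ℕ) ≃ₜ ↥(PosBall ℕ), ∀ x y : ↥(Ball ℕ),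
      (∑' n, |x.1 n|) < (∑' n, |y.1 n|) → (∑' n, |(f x).1 n|) < (∑' n, |(f y).1 n|)) :
    ∃ f : ↥(Ball ℕ) ≃ₜ ↥(PosBall ℕ), ∀ x : ↥(Ball ℕ),
      (∑' n, |(f x).1 n|) = ∑' n, |x.1 n| := by
  obtain ⟨f, hf⟩ := h
  let p : Icc (0 : ℝ) 1 → ↥(Ball ℕ) := fun t => ⟨Pi.single 0 t.1, (single_mem t.2).1.1⟩
  have hp : ∀ t, ∑' n, |(p t).1 n| = t.1 := fun t => (single_mem t.2).2
  let φ : Icc (0 : ℝ) 1 → Icc (0 : ℝ) 1 := fun t =>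
    ⟨∑' n, |(f (p t)).1 n|, tsum_abs_mem (f (p t)).2.1⟩
  have hφ : StrictMono φ := by
    intro s t hst
    refine hf _ _ ?_
    rw [hp, hp]
    exact hst
  have hfφ : ∀ x : ↥(Ball ℕ), ∑' n, |(f x).1 n| = φ ⟨∑' n, |x.1 n|, tsum_abs_mem x.2⟩ := by
    intro x
    have h1 := hp ⟨∑' n, |x.1 n|, tsum_abs_mem x.2⟩
    exact le_antisymm (norm_eq_aux f hf _ _ h1) (norm_eq_aux f hf _ _ h1.symm)
  have hs : Function.Surjective φ := by
    intro t
    let y : ↥(PosBall ℕ) := ⟨Pi.single 0 t.1, (single_mem t.2).1⟩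
    refine ⟨⟨∑' n, |(f.symm y).1 n|, tsum_abs_mem (f.symm y).2⟩, Subtype.ext ?_⟩
    rw [← hfφ, f.apply_symm_apply]
    exact (single_mem t.2).2
  let Φ : Icc (0 : ℝ) 1 ≃o Icc (0 : ℝ) 1 := hφ.orderIsoOfSurjective φ hs
  refine ⟨f.trans (repHomeo Φ.symm), fun x => ?_⟩
  change ∑' n, |(repHomeo Φ.symm (f x)).1 n| = _
  rw [tsum_repHomeo]
  have : (⟨∑' n, |(f x).1 n|, tsum_abs_mem (f x).2.1⟩ : Icc (0 : ℝ) 1) =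
      Φ ⟨∑' n, |x.1 n|, tsum_abs_mem x.2⟩ := Subtype.ext (hfφ x)
  rw [this, Φ.symm_apply_apply]

/-! ### (4) implies (1) -/

lemma reindex_mem {ι κ : Type*} (e : ι ≃ κ) {x : ι → ℝ} (hx : x ∈ Ball ι) :
    (fun k => x (e.symm k)) ∈ Ball κ := by
  intro s
  have := hx (s.map e.symm.toEmbedding)
  simpa using this

/-- Reindexing. -/
def reindexBall {ι κ : Type*} (e : ι ≃ κ) : ↥(Ball ι) ≃ₜ ↥(Ball κ) where
  toFun x := ⟨_, reindex_mem e x.2⟩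
  invFun x := ⟨_, reindex_mem e.symm x.2⟩
  left_inv x := by ext i; simp
  right_inv x := by ext i; simp
  continuous_toFun := Continuous.subtype_mk
    (continuous_pi fun _ => continuous_coord _ _) _
  continuous_invFun := Continuous.subtype_mk
    (continuous_pi fun _ => continuous_coord _ _) _

/-- Reindexing. -/
def reindexPosBall {ι κ : Type*} (e : ι ≃ κ) : ↥(PosBall ι) ≃ₜ ↥(PosBall κ) where
  toFun x := ⟨_, reindex_mem e x.2.1, fun _ => x.2.2 _⟩
  invFun x := ⟨_, reindex_mem e.symm x.2.1, fun _ => x.2.2 _⟩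
  left_inv x := by ext i; simp
  right_inv x := by ext i; simp
  continuous_toFun := Continuous.subtype_mk
    (continuous_pi fun _ => continuous_coord _ _) _
  continuous_invFun := Continuous.subtype_mk
    (continuous_pi fun _ => continuous_coord _ _) _

lemma slice_mem {Γ : Type} {x : Γ × ℕ → ℝ} (hx : x ∈ Ball (Γ × ℕ)) (γ : Γ) :
    (fun n => x (γ, n)) ∈ Ball ℕ := by
  classical
  intro s
  have := hx (({γ} : Finset Γ) ×ˢ s)
  rw [Finset.sum_product] at this
  simpa using this

lemma ball_prod_iff {Γ : Type} {x : Γ × ℕ → ℝ} (h : ∀ γ, (fun n => x (γ, n)) ∈ Ball ℕ) :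
    x ∈ Ball (Γ × ℕ) ↔ ∀ S : Finset Γ, ∑ γ ∈ S, ∑' n, |x (γ, n)| ≤ 1 := by
  classical
  constructor
  · intro hx S
    have ht : Tendsto (fun N => ∑ γ ∈ S, ∑ n ∈ Finset.range N, |x (γ, n)|) atTop
        (𝓝 (∑ γ ∈ S, ∑' n, |x (γ, n)|)) :=
      tendsto_finsetSum _ fun γ _ => (summable_of_ball (h γ)).hasSum.tendsto_sum_nat
    refine le_of_tendsto ht (Eventually.of_forall fun N => ?_)
    have := hx (S ×ˢ Finset.range N)
    rwa [Finset.sum_product] at this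
  · intro hS s
    have hsub : s ⊆ s.image Prod.fst ×ˢ s.image Prod.snd := Finset.subset_product
    refine (Finset.sum_le_sum_of_subset_of_nonneg hsub fun _ _ _ => abs_nonneg _).trans ?_
    rw [Finset.sum_product]
    exact (Finset.sum_le_sum fun γ _ => (summable_of_ball (h γ)).sum_le_tsum _
      fun _ _ => abs_nonneg _).trans (hS _)

lemma imp41 (h : ∃ f : ↥(Ball ℕ) ≃ₜ ↥(PosBall ℕ), ∀ x : ↥(Ball ℕ),
      (∑' n, |(f x).1 n|) = ∑' n, |x.1 n|) (Γ : Type) [Infinite Γ] :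
    Nonempty (↥(Ball Γ) ≃ₜ ↥(PosBall Γ)) := by
  obtain ⟨f, hf⟩ := h
  obtain ⟨e⟩ : Nonempty (Γ ≃ Γ × ℕ) := by
    rw [← Cardinal.eq, Cardinal.mk_prod]
    simp
  have hf' : ∀ y : ↥(PosBall ℕ), ∑' n, |(f.symm y).1 n| = ∑' n, |y.1 n| := by
    intro y
    rw [← hf, f.apply_symm_apply]
  let F : ↥(Ball (Γ × ℕ)) ≃ₜ ↥(PosBall (Γ × ℕ)) :=
    { toFun := fun x => ⟨fun p => (f ⟨_, slice_mem x.2 p.1⟩).1 p.2, by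
        refine ⟨(ball_prod_iff fun γ => (f ⟨_, slice_mem x.2 γ⟩).2.1).2 fun S => ?_,
          fun p => (f ⟨_, slice_mem x.2 p.1⟩).2.2 _⟩
        refine le_trans (Finset.sum_congr rfl fun γ _ => hf ⟨_, slice_mem x.2 γ⟩).le ?_
        exact (ball_prod_iff fun γ => slice_mem x.2 γ).1 x.2 S⟩
      invFun := fun y => ⟨fun p => (f.symm ⟨_, slice_mem y.2.1 p.1, fun _ => y.2.2 _⟩).1 p.2, by
        refine (ball_prod_iff fun γ =>
          (f.symm ⟨_, slice_mem y.2.1 γ, fun _ => y.2.2 _⟩).2).2 fun S => ?_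
        refine le_trans (Finset.sum_congr rfl fun γ _ =>
          hf' ⟨_, slice_mem y.2.1 γ, fun _ => y.2.2 _⟩).le ?_
        exact (ball_prod_iff fun γ => slice_mem y.2.1 γ).1 y.2.1 S⟩
      left_inv := by
        intro x
        apply Subtype.ext
        funext p
        exact congrFun (congrArg Subtype.val (f.symm_apply_apply ⟨_, slice_mem x.2 p.1⟩)) p.2
      right_inv := by
        intro x
        apply Subtype.ext
        funext p
        exact congrFun (congrArg Subtype.val
          (f.apply_symm_apply ⟨_, slice_mem x.2.1 p.1, fun _ => x.2.2 _⟩)) p.2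
      continuous_toFun := by
        refine Continuous.subtype_mk (continuous_pi fun p => ?_) _
        refine (continuous_coord _ p.2).comp (f.continuous.comp ?_)
        exact Continuous.subtype_mk (continuous_pi fun n => continuous_coord _ _) _
      continuous_invFun := by
        refine Continuous.subtype_mk (continuous_pi fun p => ?_) _
        refine (continuous_coord _ p.2).comp (f.symm.continuous.comp ?_)
        exact Continuous.subtype_mk (continuous_pi fun n => continuous_coord _ _) _ }
  exact ⟨(reindexBall e).trans (F.trans (reindexPosBall e.symm))⟩

/-! ### A norm preserving homeomorphism from the ball onto the cube -/

/-- The small parameters. -/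
def dl (n : ℕ) : ℝ := (1 / 4) ^ (n + 1)

lemma dl_pos (n : ℕ) : 0 < dl n := by unfold dl; positivity

lemma dl_le (n : ℕ) : dl n ≤ 1 / 4 := by
  unfold dl
  rw [pow_succ]
  have : ((1 : ℝ) / 4) ^ n ≤ 1 := pow_le_one₀ (by norm_num) (by norm_num)
  linarith

/-- Partial sums of absolute values. -/
def sa (x : ℕ → ℝ) (n : ℕ) : ℝ := ∑ i ∈ Finset.range n, |x i|

lemma sa_succ (x : ℕ → ℝ) (n : ℕ) : sa x (n + 1) = sa x n + |x n| := Finset.sum_range_succ _ _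

lemma sa_nonneg (x : ℕ → ℝ) (n : ℕ) : 0 ≤ sa x n := Finset.sum_nonneg fun _ _ => abs_nonneg _

lemma continuous_sa (n : ℕ) : Continuous fun x : ℕ → ℝ => sa x n :=
  continuous_finsetSum _ fun i _ => (continuous_apply i).abs

/-- Clipping. -/
def cl (s y : ℝ) : ℝ := max (-s) (min s y)

lemma cl_of_nonneg {s y : ℝ} (hs : 0 ≤ s) (hy : 0 ≤ y) : cl s y = min s y := by
  unfold cl
  have : 0 ≤ min s y := le_min hs hy
  exact max_eq_right (by linarith)

lemma cl_neg {s : ℝ} (hs : 0 ≤ s) (y : ℝ) : cl s (-y) = -cl s y := by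
  unfold cl
  rcases le_total s y with h | h <;> rcases le_total (-s) y with h' | h' <;>
    rcases le_total s (-y) with h3 | h3 <;> rcases le_total (-s) (-y) with h4 | h4 <;>
    simp [h, h', h3, h4] <;> grind

lemma abs_cl {s : ℝ} (hs : 0 ≤ s) (y : ℝ) : |cl s y| = min s |y| := by
  rcases le_total 0 y with h | h
  · rw [cl_of_nonneg hs h, abs_of_nonneg h, abs_of_nonneg (le_min hs h)]
  · have h' : 0 ≤ -y := by linarith
    rw [← neg_neg y, cl_neg hs, abs_neg, abs_neg, cl_of_nonneg hs h', abs_of_nonneg h',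
      abs_of_nonneg (le_min hs h')]

/-- The multiplicative factor. -/
def fac (x : ℕ → ℝ) (n : ℕ) : ℝ := min (sa x (n + 1) / sa x n) (1 / (1 - dl n))

/-- The approximating maps. -/
def T : ℕ → (ℕ → ℝ) → ℕ → ℝ
  | 0, _ => 0
  | n + 1, x => fun i => if i = n then cl (sa x (n + 1)) (x n / dl n) else T n x i * fac x n

lemma T_self (n : ℕ) (x : ℕ → ℝ) : T (n + 1) x n = cl (sa x (n + 1)) (x n / dl n) := by
  simp [T]

lemma T_ne (n : ℕ) (x : ℕ → ℝ) {i : ℕ} (h : i ≠ n) : T (n + 1) x i = T n x i * fac x n := by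
  simp [T, h]

lemma T_zero (n : ℕ) (x : ℕ → ℝ) {i : ℕ} (h : n ≤ i) : T n x i = 0 := by
  induction n with
  | zero => rfl
  | succ n ih => rw [T_ne n x (by omega), ih (by omega), zero_mul]

/-- Maximum of the first `n` absolute values. -/
def M (t : ℕ → ℝ) : ℕ → ℝ
  | 0 => 0
  | n + 1 => max (M t n) |t n|

lemma M_nonneg (t : ℕ → ℝ) (n : ℕ) : 0 ≤ M t n := by
  induction n with
  | zero => exact le_rfl
  | succ n ih => exact ih.trans (le_max_left _ _)

lemma le_M (t : ℕ → ℝ) {n i : ℕ} (h : i < n) : |t i| ≤ M t n := by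
  induction n with
  | zero => omega
  | succ n ih =>
    rcases Nat.lt_succ_iff_lt_or_eq.1 h with h | rfl
    · exact (ih h).trans (le_max_left _ _)
    · exact le_max_right _ _

lemma M_le (t : ℕ → ℝ) {n : ℕ} {c : ℝ} (hc : 0 ≤ c) (h : ∀ i < n, |t i| ≤ c) : M t n ≤ c := by
  induction n with
  | zero => exact hc
  | succ n ih => exact max_le (ih fun i hi => h i (by omega)) (h n (by omega))

lemma M_mul (t t' : ℕ → ℝ) {n : ℕ} {c : ℝ} (hc : 0 ≤ c) (h : ∀ i < n, t' i = t i * c) :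
    M t' n = M t n * c := by
  induction n with
  | zero => simp [M]
  | succ n ih =>
    simp only [M]
    rw [ih fun i hi => h i (by omega), h n (by omega), abs_mul, abs_of_nonneg hc,
      max_mul_of_nonneg _ _ hc]

lemma M_lip (t t' : ℕ → ℝ) {n : ℕ} {D : ℝ} (hD : 0 ≤ D) (h : ∀ i < n, |t i - t' i| ≤ D) :
    |M t n - M t' n| ≤ D := by
  induction n with
  | zero => simpa [M] using hD
  | succ n ih =>
    simp only [M]
    refine (abs_max_sub_max_le_max _ _ _ _).trans (max_le (ih fun i hi => h i (by omega)) ?_)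
    exact (abs_abs_sub_abs_le _ _).trans (h n (by omega))

lemma fac_nonneg (x : ℕ → ℝ) (n : ℕ) : 0 ≤ fac x n := by
  have := dl_le n
  refine le_min (div_nonneg (sa_nonneg _ _) (sa_nonneg _ _)) (div_nonneg zero_le_one (by linarith))

lemma fac_le (x : ℕ → ℝ) (n : ℕ) : fac x n ≤ 1 / (1 - dl n) := min_le_right _ _

lemma one_le_fac {x : ℕ → ℝ} {n : ℕ} (h : 0 < sa x n) : 1 ≤ fac x n := by
  have h1 := dl_le n
  have h2 := dl_pos n
  refine le_min ?_ ?_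
  · rw [one_le_div h, sa_succ]; linarith [abs_nonneg (x n)]
  · rw [one_le_div (by linarith)]; linarith

lemma M_T (n : ℕ) (x : ℕ → ℝ) : M (T n x) n = sa x n := by
  induction n with
  | zero => simp [M, sa]
  | succ n ih =>
    have h1 := dl_le n
    have h2 := dl_pos n
    have hs := sa_nonneg x n
    have hs' := sa_nonneg x (n + 1)
    have hss := sa_succ x n
    have hx := abs_nonneg (x n)
    simp only [M]
    rw [M_mul (T n x) (T (n + 1) x) (fac_nonneg x n) (fun i hi => T_ne n x hi.ne), ih, T_self,
      abs_cl hs', abs_div, abs_of_pos h2]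
    have h3 : sa x n * fac x n ≤ sa x (n + 1) := by
      rcases hs.eq_or_lt with h0 | h0
      · rw [← h0]; simpa using hs'
      · calc sa x n * fac x n ≤ sa x n * (sa x (n + 1) / sa x n) := by
              gcongr; exact min_le_left _ _
          _ = sa x (n + 1) := by field_simp
    rcases le_total (sa x (n + 1)) (|x n| / dl n) with h | h
    · rw [min_eq_left h, max_eq_right h3]
    · rw [min_eq_right h]
      rw [div_le_iff₀ h2] at h
      apply le_antisymm (max_le h3 (by rwa [div_le_iff₀ h2]))
      rcases hs.eq_or_lt with h0 | h0
      · refine le_trans ?_ (le_max_right _ _)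
        rw [hss, ← h0, zero_add, le_div_iff₀ h2]
        nlinarith
      · refine le_trans ?_ (le_max_left _ _)
        have : fac x n = sa x (n + 1) / sa x n := by
          apply min_eq_left
          rw [div_le_div_iff₀ h0 (by linarith)]
          nlinarith
        rw [this]
        field_simp
        exact le_rfl

lemma abs_T_le (n : ℕ) (x : ℕ → ℝ) (i : ℕ) : |T n x i| ≤ sa x n := by
  rcases lt_or_ge i n with h | h
  · rw [← M_T]; exact le_M _ h
  · rw [T_zero n x h, abs_zero]; exact sa_nonneg x n

lemma T_eq_zero {n : ℕ} {x : ℕ → ℝ} (h : sa x n = 0) (i : ℕ) : T n x i = 0 :=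
  abs_eq_zero.1 (le_antisymm ((abs_T_le n x i).trans h.le) (abs_nonneg _))

lemma abs_T_mono_succ (n : ℕ) (x : ℕ → ℝ) (i : ℕ) : |T n x i| ≤ |T (n + 1) x i| := by
  rcases eq_or_ne i n with rfl | h
  · rw [T_zero i x le_rfl, abs_zero]; exact abs_nonneg _
  · rcases (sa_nonneg x n).eq_or_lt with h0 | h0
    · rw [T_eq_zero h0.symm, abs_zero]; exact abs_nonneg _
    · rw [T_ne n x h, abs_mul, abs_of_nonneg (fac_nonneg x n)]
      exact le_mul_of_one_le_right (abs_nonneg _) (one_le_fac h0)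

lemma abs_T_mono (x : ℕ → ℝ) (i : ℕ) : Monotone fun n => |T n x i| :=
  monotone_nat_of_le_succ fun n => abs_T_mono_succ n x i

lemma sa_le_one {x : ℕ → ℝ} (hx : x ∈ Ball ℕ) (n : ℕ) : sa x n ≤ 1 := hx _

lemma T_dist {x : ℕ → ℝ} (hx : x ∈ Ball ℕ) {n i : ℕ} (h : i < n) :
    |T n x i - T (n + 1) x i| ≤ 2 * dl n := by
  have h1 := dl_le n
  have h2 := dl_pos n
  rcases (sa_nonneg x n).eq_or_lt with h0 | h0
  · rw [T_ne n x h.ne, T_eq_zero h0.symm]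
    simp [h2.le]
  · have h3 := one_le_fac h0
    have h4 : fac x n ≤ 1 + 2 * dl n := by
      refine (fac_le x n).trans ?_
      rw [div_le_iff₀ (by linarith)]
      nlinarith
    have h5 : |T n x i| ≤ 1 := (abs_T_le n x i).trans (sa_le_one hx n)
    have h6 : T n x i - T (n + 1) x i = T n x i * (1 - fac x n) := by
      rw [T_ne n x h.ne]; ring
    rw [h6, abs_mul, abs_of_nonpos (by linarith : 1 - fac x n ≤ 0)]
    nlinarith [abs_nonneg (T n x i)]

lemma T_back (n : ℕ) (x : ℕ → ℝ) {i : ℕ} (h : i ≠ n) :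
    T n x i = T (n + 1) x i * (1 - dl n * (|T (n + 1) x n| / sa x (n + 1))) := by
  have h1 := dl_le n
  have h2 := dl_pos n
  have hs' := sa_nonneg x (n + 1)
  have hss := sa_succ x n
  have hx := abs_nonneg (x n)
  rw [T_ne n x h]
  rcases (sa_nonneg x n).eq_or_lt with h0 | h0
  · rw [T_eq_zero h0.symm]; simp
  · have hp : 0 < sa x (n + 1) := by linarith
    suffices hk : fac x n * (1 - dl n * (|T (n + 1) x n| / sa x (n + 1))) = 1 by
      rw [mul_assoc, hk, mul_one]
    rw [T_self, abs_cl hs', abs_div, abs_of_pos h2]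
    rcases le_total (sa x (n + 1)) (|x n| / dl n) with h3 | h3
    · rw [min_eq_left h3]
      rw [le_div_iff₀ h2] at h3
      have : fac x n = 1 / (1 - dl n) := by
        apply min_eq_right
        rw [div_le_div_iff₀ (by linarith) h0]
        nlinarith
      rw [this]
      have h5 : (1 - dl n) ≠ 0 := by linarith
      field_simp
    · rw [min_eq_right h3]
      rw [div_le_iff₀ h2] at h3
      have : fac x n = sa x (n + 1) / sa x n := by
        apply min_eq_left
        rw [div_le_div_iff₀ h0 (by linarith)]
        nlinarith
      rw [this]
      field_simp
      rw [hss]; ring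

lemma continuous_T (n i : ℕ) : Continuous fun x : ℕ → ℝ => T n x i := by
  induction n with
  | zero => exact continuous_const
  | succ n ih =>
    rcases eq_or_ne i n with rfl | h
    · simp only [T_self, cl]
      have := continuous_sa (i + 1)
      fun_prop
    · simp only [T_ne n _ h]
      rw [continuous_iff_continuousAt]
      intro x
      rcases (sa_nonneg x n).eq_or_lt with h0 | h0
      · have hz : T n x i * fac x n = 0 := by rw [T_eq_zero h0.symm, zero_mul]
        rw [ContinuousAt, hz]
        have hg : Tendsto (fun y => |T n y i| * (1 / (1 - dl n))) (𝓝 x) (𝓝 0) := by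
          have := (ih.abs.mul_const (1 / (1 - dl n))).tendsto x
          rwa [T_eq_zero h0.symm, abs_zero, zero_mul] at this
        refine squeeze_zero_norm (fun y => ?_) hg
        rw [Real.norm_eq_abs, abs_mul, abs_of_nonneg (fac_nonneg y n)]
        exact mul_le_mul_of_nonneg_left (fac_le y n) (abs_nonneg _)
      · refine ih.continuousAt.mul ?_
        unfold fac
        exact ((continuous_sa (n + 1)).continuousAt.div (continuous_sa n).continuousAt h0.ne').min
          continuousAt_const

/-- The limit map. -/
def FF (x : ℕ → ℝ) (i : ℕ) : ℝ := limUnder atTop fun n => T n x i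

lemma T_dist' {x : ℕ → ℝ} (hx : x ∈ Ball ℕ) {n i : ℕ} (h : i < n) (k : ℕ) :
    dist (T (k + n) x i) (T (k + 1 + n) x i) ≤ (2 * dl n) * (1 / 4) ^ k := by
  have := T_dist hx (n := k + n) (i := i) (by omega)
  rw [Real.dist_eq]
  have h2 : k + 1 + n = k + n + 1 := by omega
  rw [h2]
  refine this.trans (le_of_eq ?_)
  unfold dl
  ring

lemma tendsto_FF {x : ℕ → ℝ} (hx : x ∈ Ball ℕ) (i : ℕ) :
    Tendsto (fun n => T n x i) atTop (𝓝 (FF x i)) := by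
  apply tendsto_nhds_limUnder
  have := cauchySeq_of_le_geometric (1 / 4) (2 * dl (i + 1)) (by norm_num)
    (T_dist' hx (Nat.lt_succ_self i))
  obtain ⟨a, ha⟩ := cauchySeq_tendsto_of_complete this
  exact ⟨a, (tendsto_add_atTop_iff_nat (f := fun n => T n x i) (i + 1)).1 ha⟩

lemma FF_dist {x : ℕ → ℝ} (hx : x ∈ Ball ℕ) {n i : ℕ} (h : i < n) :
    |T n x i - FF x i| ≤ (1 / 4) ^ n := by
  have := dist_le_of_le_geometric_of_tendsto₀ (1 / 4) (2 * dl n) (by norm_num) (T_dist' hx h)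
    ((tendsto_add_atTop_iff_nat (f := fun n => T n x i) n).2 (tendsto_FF hx i))
  rw [Real.dist_eq, zero_add] at this
  refine this.trans ?_
  unfold dl
  rw [pow_succ]
  have : (0 : ℝ) ≤ (1 / 4) ^ n := by positivity
  rw [div_le_iff₀ (by norm_num)]
  linarith

lemma continuous_FF (i : ℕ) : Continuous fun x : ↥(Ball ℕ) => FF x.1 i := by
  have h : TendstoUniformly (fun n (x : ↥(Ball ℕ)) => T n x.1 i) (fun x => FF x.1 i) atTop := by
    rw [Metric.tendstoUniformly_iff]
    intro ε hε
    have h1 : Tendsto (fun n : ℕ => ((1 : ℝ) / 4) ^ n) atTop (𝓝 0) :=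
      tendsto_pow_atTop_nhds_zero_of_lt_one (by norm_num) (by norm_num)
    filter_upwards [h1.eventually (gt_mem_nhds hε), eventually_gt_atTop i] with n hn hi x
    rw [dist_comm, Real.dist_eq]
    exact (FF_dist x.2 hi).trans_lt hn
  exact h.continuous (Frequently.of_forall fun n =>
    (continuous_T n i).comp continuous_subtype_val)

lemma abs_T_le_FF {x : ℕ → ℝ} (hx : x ∈ Ball ℕ) (n i : ℕ) : |T n x i| ≤ |FF x i| :=
  (abs_T_mono x i).ge_of_tendsto (tendsto_FF hx i).abs n

lemma abs_FF_le {x : ℕ → ℝ} (hx : x ∈ Ball ℕ) (i : ℕ) : |FF x i| ≤ ∑' n, |x n| :=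
  le_of_tendsto (tendsto_FF hx i).abs (Eventually.of_forall fun n =>
    (abs_T_le n x i).trans ((summable_of_ball hx).sum_le_tsum _ fun _ _ => abs_nonneg _))

lemma iSup_FF {x : ℕ → ℝ} (hx : x ∈ Ball ℕ) : ⨆ i, |FF x i| = ∑' n, |x n| := by
  apply le_antisymm (ciSup_le (abs_FF_le hx))
  have hb : BddAbove (range fun i => |FF x i|) := ⟨_, by rintro _ ⟨i, rfl⟩; exact abs_FF_le hx i⟩
  refine le_of_tendsto (summable_of_ball hx).hasSum.tendsto_sum_nat
    (Eventually.of_forall fun n => ?_)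
  change sa x n ≤ _
  rw [← M_T]
  refine M_le _ ((abs_nonneg _).trans (le_ciSup hb 0)) fun i _ => ?_
  exact (abs_T_le_FF hx n i).trans (le_ciSup hb i)

lemma lip_aux {a b c d s s' D : ℝ} (hs : 0 ≤ s) (hs' : 0 ≤ s') (hc : |c| ≤ s)
    (hb : |b| ≤ s') (hd : |d| ≤ s') (hab : |a - b| ≤ D) (hcd : |c - d| ≤ D) (hss : |s - s'| ≤ D) :
    |a * (c / s) - b * (d / s')| ≤ 3 * D := by
  have div_facts : ∀ p q : ℝ, 0 ≤ q → |p| ≤ q → |p / q| ≤ 1 ∧ p / q * q = p := by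
    intro p q hq hp
    rcases hq.eq_or_lt with h | h
    · have : p = 0 := abs_eq_zero.1 (le_antisymm (h ▸ hp) (abs_nonneg _))
      simp [this]
    · refine ⟨?_, by field_simp⟩
      rw [abs_div, abs_of_pos h, div_le_one h]
      exact hp
  obtain ⟨h1, h2⟩ := div_facts c s hs hc
  obtain ⟨h3, h4⟩ := div_facts d s' hs' hd
  obtain ⟨h5, h6⟩ := div_facts b s' hs' hb
  set α := c / s
  set β := d / s'
  set κ := b / s'
  have e : a * α - b * β = (a - b) * α + κ * (α * (s' - s) + (c - d)) := by
    linear_combination (-(α - β)) * h6 + κ * h2 - κ * h4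
  rw [e]
  have i1 : |(a - b) * α| ≤ D := by
    rw [abs_mul]; nlinarith [abs_nonneg (a - b), abs_nonneg α]
  have i2 : |α * (s' - s)| ≤ D := by
    rw [abs_mul, abs_sub_comm s' s]; nlinarith [abs_nonneg (s - s'), abs_nonneg α]
  have i3 : |α * (s' - s) + (c - d)| ≤ 2 * D := (abs_add_le _ _).trans (by linarith)
  have i4 : |κ * (α * (s' - s) + (c - d))| ≤ 2 * D := by
    rw [abs_mul]; nlinarith [abs_nonneg (α * (s' - s) + (c - d)), abs_nonneg κ]
  exact (abs_add_le _ _).trans (by linarith)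

lemma T_lip (n : ℕ) (x y : ℕ → ℝ) {D : ℝ} (hD : 0 ≤ D)
    (h : ∀ i, |T (n + 1) x i - T (n + 1) y i| ≤ D) (i : ℕ) : |T n x i - T n y i| ≤ 2 * D := by
  rcases eq_or_ne i n with rfl | hi
  · rw [T_zero i x le_rfl, T_zero i y le_rfl]; simpa using hD
  · have h1 := dl_le n
    have h2 := dl_pos n
    have hss : |sa x (n + 1) - sa y (n + 1)| ≤ D := by
      rw [← M_T, ← M_T]; exact M_lip _ _ hD fun i _ => h i
    have key := lip_aux (a := T (n + 1) x i) (b := T (n + 1) y i) (c := |T (n + 1) x n|)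
      (d := |T (n + 1) y n|) (sa_nonneg x (n + 1)) (sa_nonneg y (n + 1))
      (by rw [abs_abs]; exact abs_T_le _ _ _) (abs_T_le _ _ _)
      (by rw [abs_abs]; exact abs_T_le _ _ _) (h i)
      ((abs_abs_sub_abs_le _ _).trans (h n)) hss
    rw [T_back n x hi, T_back n y hi]
    have e : ∀ a b p q δ : ℝ, a * (1 - δ * p) - b * (1 - δ * q) =
        (a - b) + -(δ * (a * p - b * q)) := by intros; ring
    rw [e]
    refine (abs_add_le _ _).trans ?_
    rw [abs_neg, abs_mul, abs_of_pos h2]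
    have := h i
    nlinarith [abs_nonneg (T (n + 1) x i * (|T (n + 1) x n| / sa x (n + 1)) -
      T (n + 1) y i * (|T (n + 1) y n| / sa y (n + 1)))]

lemma T_lip_iter (k n : ℕ) (x y : ℕ → ℝ) {D : ℝ} (hD : 0 ≤ D)
    (h : ∀ i, |T (n + k) x i - T (n + k) y i| ≤ D) (i : ℕ) : |T n x i - T n y i| ≤ 2 ^ k * D := by
  induction k generalizing D with
  | zero => simpa using h i
  | succ k ih =>
    have := ih (D := 2 * D) (by linarith) (T_lip (n + k) x y hD h)
    rw [pow_succ]
    linarith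

lemma FF_inj {x y : ℕ → ℝ} (hx : x ∈ Ball ℕ) (hy : y ∈ Ball ℕ) (h : FF x = FF y) : x = y := by
  have hT : ∀ n i, T n x i = T n y i := by
    intro n i
    have hb : ∀ k, |T n x i - T n y i| ≤ 2 * (1 / 2) ^ k := by
      intro k
      have := T_lip_iter k n x y (D := 2 * (1 / 4) ^ (n + k)) (by positivity) (fun j => by
        rcases lt_or_ge j (n + k) with hj | hj
        · have h1 := FF_dist hx hj
          have h2 := FF_dist hy hj
          rw [h] at h1
          rw [abs_sub_comm] at h2
          have e : T (n + k) x j - T (n + k) y j =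
            (T (n + k) x j - FF y j) + (FF y j - T (n + k) y j) := by ring
          rw [e]
          exact (abs_add_le _ _).trans (by linarith)
        · rw [T_zero _ x hj, T_zero _ y hj]
          simp) i
      refine this.trans ?_
      have h4 : ((1 : ℝ) / 4) ^ n ≤ 1 := pow_le_one₀ (by norm_num) (by norm_num)
      have h5 : (2 : ℝ) ^ k * (1 / 4) ^ k = (1 / 2) ^ k := by rw [← mul_pow]; norm_num
      have h6 : (0 : ℝ) ≤ (1 / 2) ^ k := by positivity
      calc (2 : ℝ) ^ k * (2 * (1 / 4) ^ (n + k)) = 2 * ((2 ^ k * (1 / 4) ^ k) * (1 / 4) ^ n) := by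
            rw [pow_add]; ring
        _ ≤ 2 * (1 / 2) ^ k := by rw [h5]; nlinarith
    have ht : Tendsto (fun k : ℕ => 2 * ((1 : ℝ) / 2) ^ k) atTop (𝓝 0) := by
      have := (tendsto_pow_atTop_nhds_zero_of_lt_one (r := (1 : ℝ) / 2) (by norm_num)
        (by norm_num)).const_mul 2
      rwa [mul_zero] at this
    have := ge_of_tendsto' ht hb
    exact sub_eq_zero.1 (abs_eq_zero.1 (le_antisymm this (abs_nonneg _)))
  have hs : ∀ n, sa x n = sa y n := by
    intro n
    rw [← M_T, ← M_T, show T n x = T n y from funext (hT n)]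
  funext n
  have habs : |x n| = |y n| := by
    have := hs (n + 1)
    rw [sa_succ, sa_succ, hs n] at this
    linarith
  have hc := hT (n + 1) n
  rw [T_self, T_self, hs (n + 1)] at hc
  have hs0 := sa_nonneg y (n + 1)
  have h2 := dl_pos n
  rcases abs_eq_abs.1 habs with h3 | h3
  · exact h3
  · rw [h3, neg_div, cl_neg hs0] at hc
    have h4 : |cl (sa y (n + 1)) (y n / dl n)| = 0 := by
      rw [abs_eq_zero]; linarith
    rw [abs_cl hs0, abs_div, abs_of_pos h2] at h4
    have h5 : y n = 0 := by
      have h6 : |y n| ≤ sa y (n + 1) := by rw [sa_succ]; linarith [sa_nonneg y n]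
      rcases min_choice (sa y (n + 1)) (|y n| / dl n) with h7 | h7
      · rw [h7] at h4
        exact abs_eq_zero.1 (le_antisymm (by linarith) (abs_nonneg _))
      · rw [h7, div_eq_zero_iff] at h4
        rcases h4 with h4 | h4
        · exact abs_eq_zero.1 h4
        · exact absurd h4 h2.ne'
    rw [h3, h5, neg_zero]

lemma sa_congr {n : ℕ} {x y : ℕ → ℝ} (h : ∀ i < n, x i = y i) : sa x n = sa y n :=
  Finset.sum_congr rfl fun i hi => by rw [h i (Finset.mem_range.1 hi)]

lemma T_congr {n : ℕ} {x y : ℕ → ℝ} (h : ∀ i < n, x i = y i) (i : ℕ) : T n x i = T n y i := by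
  induction n with
  | zero => rfl
  | succ n ih =>
    rcases eq_or_ne i n with rfl | hi
    · rw [T_self, T_self, sa_congr h, h i (Nat.lt_succ_self i)]
    · rw [T_ne n x hi, T_ne n y hi, ih fun i hi => h i (by omega), fac, fac, sa_congr h,
        sa_congr (n := n) fun i hi => h i (by omega)]

lemma T_surj (n : ℕ) (t : ℕ → ℝ) (ht : ∀ i, n ≤ i → t i = 0) :
    ∃ x : ℕ → ℝ, (∀ i, n ≤ i → x i = 0) ∧ T n x = t := by
  induction n generalizing t with
  | zero => exact ⟨0, fun _ _ => rfl, funext fun i => (ht i (Nat.zero_le i)).symm⟩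
  | succ n ih =>
    have h1 := dl_le n
    have h2 := dl_pos n
    set s := M t (n + 1) with hs
    have hs0 : 0 ≤ s := M_nonneg _ _
    set r := 1 - dl n * (|t n| / s) with hr
    have hq : |t n| / s ≤ 1 := div_le_one_of_le₀ (le_M t (Nat.lt_succ_self n)) hs0
    have hq0 : 0 ≤ |t n| / s := div_nonneg (abs_nonneg _) hs0
    have hr0 : 0 < r := by nlinarith
    have hr1 : r ≤ 1 := by nlinarith
    obtain ⟨x', hx', hT⟩ := ih (fun i => if i < n then t i * r else 0)
      (fun i hi => by simp [not_lt.2 hi])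
    set m := sa x' n with hm
    have hm' : m = M t n * r := by
      rw [hm, ← M_T, hT]
      exact M_mul _ _ hr0.le fun i hi => by simp [hi]
    have hM0 := M_nonneg t n
    have hMs : M t n ≤ s := le_max_left _ _
    have hts : |t n| ≤ s := le_max_right _ _
    have hms : m ≤ s := by nlinarith
    have hm0 : 0 ≤ m := sa_nonneg _ _
    let x : ℕ → ℝ := fun i => if i = n then (if 0 ≤ t n then s - m else -(s - m)) else x' i
    have hxn : |x n| = s - m := by
      simp only [x, if_true]
      split_ifs
      · exact abs_of_nonneg (by linarith)
      · rw [abs_neg]; exact abs_of_nonneg (by linarith)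
    have hxx : ∀ i < n, x i = x' i := fun i hi => by simp [x, hi.ne]
    have hsn : sa x n = m := sa_congr hxx
    have hsn1 : sa x (n + 1) = s := by rw [sa_succ, hsn, hxn]; ring
    -- the two cases
    have hkey : min s ((s - m) / dl n) = |t n| ∧
        (0 < M t n → r * min (s / m) (1 / (1 - dl n)) = 1) := by
      rcases hts.eq_or_lt with he | hl
      · rcases hs0.eq_or_lt with h0 | h0
        · have hM : M t n = 0 := le_antisymm (by linarith) hM0
          constructor
          · rw [he, hm', ← h0, hM]; simp
          · intro h; linarith
        · have hrr : r = 1 - dl n := by rw [hr, he, div_self h0.ne', mul_one]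
          constructor
          · rw [he]
            apply min_eq_left
            rw [le_div_iff₀ h2, hm', hrr]
            nlinarith
          · intro hMp
            have hmp : 0 < m := by rw [hm']; positivity
            have : min (s / m) (1 / (1 - dl n)) = 1 / (1 - dl n) := by
              apply min_eq_right
              rw [div_le_div_iff₀ (by linarith) hmp, hm', hrr]
              nlinarith
            rw [this, hrr]
            have h5 : (1 - dl n) ≠ 0 := by linarith
            field_simp
      · have hMeq : M t n = s := by
          rcases max_choice (M t n) |t n| with h | h
          · exact h.symm
          · exact absurd (show s = |t n| from h) (by linarith)
        have hsp : 0 < s := lt_of_le_of_lt (abs_nonneg _) hl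
        have hme : m = s - dl n * |t n| := by
          rw [hm', hMeq, hr]; field_simp
        constructor
        · have : (s - m) / dl n = |t n| := by rw [hme]; field_simp; ring
          rw [this]
          exact min_eq_right hts
        · intro _
          have hmp : 0 < m := by rw [hm']; rw [hMeq]; positivity
          have : min (s / m) (1 / (1 - dl n)) = s / m := by
            apply min_eq_left
            rw [div_le_div_iff₀ hmp (by linarith), hme]
            nlinarith
          rw [this, hm', hMeq]
          field_simp
    refine ⟨x, fun i hi => ?_, ?_⟩
    · have : i ≠ n := by omega
      simp only [x, this, if_false]
      exact hx' i (by omega)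
    · funext i
      rcases eq_or_ne i n with rfl | hi
      · rw [T_self, hsn1]
        have hnn : 0 ≤ (s - m) / dl i := div_nonneg (by linarith) h2.le
        by_cases h0 : 0 ≤ t i
        · have : x i = s - m := by simp [x, h0]
          rw [this, cl_of_nonneg hs0 hnn, hkey.1, abs_of_nonneg h0]
        · have : x i = -(s - m) := by simp [x, h0]
          rw [this, neg_div, cl_neg hs0, cl_of_nonneg hs0 hnn, hkey.1, abs_of_neg (not_le.1 h0),
            neg_neg]
      · rw [T_ne n x hi, T_congr hxx, hT]
        rcases lt_or_ge i n with hin | hin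
        · simp only [hin, if_true]
          rcases hM0.eq_or_lt with h0 | h0
          · have : t i = 0 := abs_eq_zero.1
              (le_antisymm ((le_M t hin).trans h0.symm.le) (abs_nonneg _))
            simp [this]
          · rw [fac, hsn, hsn1, mul_assoc, hkey.2 h0, mul_one]
        · rw [ht i (by omega)]
          simp [not_lt.2 hin]

lemma T_stable {n : ℕ} {x : ℕ → ℝ} (h : ∀ i, n ≤ i → x i = 0) (k i : ℕ) :
    T (n + k) x i = T n x i := by
  induction k with
  | zero => rfl
  | succ k ih =>
    have h1 := dl_le (n + k)
    have h2 := dl_pos (n + k)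
    have hx : x (n + k) = 0 := h _ (by omega)
    change T (n + k + 1) x i = _
    rcases eq_or_ne i (n + k) with rfl | hi
    · rw [T_self, T_zero n x (by omega), hx, zero_div, cl_of_nonneg (sa_nonneg _ _) le_rfl]
      exact min_eq_right (sa_nonneg _ _)
    · rw [T_ne _ x hi]
      rcases (sa_nonneg x (n + k)).eq_or_lt with h0 | h0
      · rw [← ih, T_eq_zero h0.symm, zero_mul]
      · have : fac x (n + k) = 1 := by
          rw [fac, sa_succ, hx, abs_zero, add_zero, div_self h0.ne']
          apply min_eq_left
          rw [one_le_div (by linarith)]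
          linarith
        rw [this, mul_one, ih]

lemma FF_surj_fin (n : ℕ) (t : ℕ → ℝ) (ht : ∀ i, n ≤ i → t i = 0) (ht1 : ∀ i, |t i| ≤ 1) :
    ∃ x ∈ Ball ℕ, FF x = t := by
  obtain ⟨x, hx, hT⟩ := T_surj n t ht
  have hxB : x ∈ Ball ℕ := by
    intro s
    have h1 : sa x n ≤ 1 := by
      rw [← M_T, hT]; exact M_le _ zero_le_one fun i _ => ht1 i
    refine le_trans ?_ h1
    have h2 : ∑ i ∈ s, |x i| = ∑ i ∈ s.filter (· < n), |x i| := by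
      rw [Finset.sum_filter]
      refine Finset.sum_congr rfl fun i _ => ?_
      split_ifs with h
      · rfl
      · rw [hx i (not_lt.1 h), abs_zero]
    rw [h2]
    refine Finset.sum_le_sum_of_subset_of_nonneg (fun i hi => ?_) fun _ _ _ => abs_nonneg _
    exact Finset.mem_range.2 (Finset.mem_filter.1 hi).2
  refine ⟨x, hxB, funext fun i => ?_⟩
  have h1 : Tendsto (fun k => T (k + n) x i) atTop (𝓝 (t i)) := by
    refine tendsto_const_nhds.congr fun k => ?_
    rw [add_comm, T_stable hx, hT]
  exact tendsto_nhds_unique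
    ((tendsto_add_atTop_iff_nat (f := fun n => T n x i) n).2 (tendsto_FF hxB i)) h1

lemma FF_surj (t : ℕ → ℝ) (ht1 : ∀ i, |t i| ≤ 1) : ∃ x ∈ Ball ℕ, FF x = t := by
  have hc : Continuous fun x : ↥(Ball ℕ) => FF x.1 := continuous_pi continuous_FF
  have : CompactSpace ↥(Ball ℕ) := isCompact_iff_compactSpace.1 (isCompact_ball ℕ)
  have hcl : IsClosed (range fun x : ↥(Ball ℕ) => FF x.1) := (isCompact_range hc).isClosed
  have hl : Tendsto (fun (n : ℕ) (i : ℕ) => if i < n then t i else 0) atTop (𝓝 t) := by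
    rw [tendsto_pi_nhds]
    intro i
    refine tendsto_const_nhds.congr' ?_
    filter_upwards [eventually_gt_atTop i] with n hn
    simp [hn]
  obtain ⟨x, hx⟩ := hcl.mem_of_tendsto hl (Eventually.of_forall fun n => by
    obtain ⟨x, hx, hF⟩ := FF_surj_fin n (fun i => if i < n then t i else 0)
      (fun i hi => by simp [not_lt.2 hi]) (fun i => by
        split_ifs
        · exact ht1 i
        · simp)
    exact ⟨⟨x, hx⟩, hF⟩)
  exact ⟨x.1, x.2, hx⟩

lemma T_sign_succ (n : ℕ) (x : ℕ → ℝ) (k : ℕ) :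
    ∃ c : ℝ, 0 ≤ c ∧ T (k + (n + 1)) x n = T (n + 1) x n * c := by
  induction k with
  | zero => exact ⟨1, zero_le_one, by simp⟩
  | succ k ih =>
    obtain ⟨c, hc, h⟩ := ih
    refine ⟨c * fac x (k + (n + 1)), mul_nonneg hc (fac_nonneg _ _), ?_⟩
    rw [show k + 1 + (n + 1) = k + (n + 1) + 1 by omega, T_ne _ x (by omega), h, mul_assoc]

lemma FF_nonneg_iff {x : ℕ → ℝ} (hx : x ∈ Ball ℕ) (n : ℕ) : 0 ≤ FF x n ↔ 0 ≤ x n := by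
  have h2 := dl_pos n
  have ht := (tendsto_add_atTop_iff_nat (f := fun k => T k x n) (n + 1)).2 (tendsto_FF hx n)
  have hs0 := sa_nonneg x (n + 1)
  constructor
  · intro h
    by_contra hcon
    rw [not_le] at hcon
    have hsp : 0 < sa x (n + 1) := by
      rw [sa_succ]; linarith [sa_nonneg x n, abs_pos.2 hcon.ne]
    have hneg : T (n + 1) x n < 0 := by
      rw [T_self, cl]
      refine max_lt (by linarith) (min_lt_of_right_lt (div_neg_of_neg_of_pos hcon h2))
    have hle : FF x n ≤ 0 := le_of_tendsto' ht fun k => by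
      obtain ⟨c, hc, hT⟩ := T_sign_succ n x k
      rw [hT]
      exact mul_nonpos_of_nonpos_of_nonneg hneg.le hc
    have h0 : FF x n = 0 := le_antisymm hle h
    have := abs_T_le_FF hx (n + 1) n
    rw [h0, abs_zero] at this
    exact absurd this (not_le.2 (abs_pos.2 hneg.ne))
  · intro h
    refine ge_of_tendsto' ht fun k => ?_
    obtain ⟨c, hc, hT⟩ := T_sign_succ n x k
    rw [hT]
    refine mul_nonneg ?_ hc
    rw [T_self, cl_of_nonneg hs0 (div_nonneg h h2.le)]
    exact le_min hs0 (div_nonneg h h2.le)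

lemma abs_FF_le_one {x : ℕ → ℝ} (hx : x ∈ Ball ℕ) (i : ℕ) : |FF x i| ≤ 1 :=
  (abs_FF_le hx i).trans (tsum_le_one hx)

lemma exists_ball_homeo : ∃ Φ : ↥(Ball ℕ) ≃ₜ (ℕ → Set.Icc (-1:ℝ) 1),
    ∀ x, (⨆ n, |(Φ x n : ℝ)|) = ∑' n, |x.1 n| := by
  have : CompactSpace ↥(Ball ℕ) := isCompact_iff_compactSpace.1 (isCompact_ball ℕ)
  let G : ↥(Ball ℕ) → (ℕ → Set.Icc (-1:ℝ) 1) := fun x n => ⟨FF x.1 n, abs_le.1 (abs_FF_le_one x.2 n)⟩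
  have hG : Continuous G := continuous_pi fun n => (continuous_FF n).subtype_mk _
  have hb : Function.Bijective G := by
    constructor
    · intro x y h
      refine Subtype.ext (FF_inj x.2 y.2 (funext fun n => ?_))
      exact congrArg Subtype.val (congrFun h n)
    · intro t
      obtain ⟨x, hx, h⟩ := FF_surj (fun n => (t n : ℝ)) fun n => abs_le.2 (t n).2
      exact ⟨⟨x, hx⟩, funext fun n => Subtype.ext (congrFun h n)⟩
  exact ⟨hG.homeoOfEquivCompactToT2 (f := Equiv.ofBijective G hb), fun x => iSup_FF x.2⟩

lemma exists_posBall_homeo : ∃ Φ : ↥(PosBall ℕ) ≃ₜ (ℕ → Set.Icc (0:ℝ) 1),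
    ∀ x, (⨆ n, |(Φ x n : ℝ)|) = ∑' n, |x.1 n| := by
  have : CompactSpace ↥(PosBall ℕ) := isCompact_iff_compactSpace.1 (isCompact_posBall ℕ)
  let G : ↥(PosBall ℕ) → (ℕ → Set.Icc (0:ℝ) 1) := fun x n =>
    ⟨FF x.1 n, (FF_nonneg_iff x.2.1 n).2 (x.2.2 n), (abs_le.1 (abs_FF_le_one x.2.1 n)).2⟩
  have hG : Continuous G := continuous_pi fun n => ((continuous_FF n).comp
    (continuous_inclusion (fun _ h => h.1 : PosBall ℕ ⊆ Ball ℕ))).subtype_mk _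
  have hb : Function.Bijective G := by
    constructor
    · intro x y h
      refine Subtype.ext (FF_inj x.2.1 y.2.1 (funext fun n => ?_))
      exact congrArg Subtype.val (congrFun h n)
    · intro t
      obtain ⟨x, hx, h⟩ := FF_surj (fun n => (t n : ℝ)) fun n =>
        abs_le.2 ⟨by linarith [(t n).2.1], (t n).2.2⟩
      refine ⟨⟨x, hx, fun n => (FF_nonneg_iff hx n).1 ?_⟩,
        funext fun n => Subtype.ext (congrFun h n)⟩
      rw [h]
      exact (t n).2.1
  exact ⟨hG.homeoOfEquivCompactToT2 (f := Equiv.ofBijective G hb), fun x => iSup_FF x.2.1⟩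

/-- the equivalence of the five statements of
Theorem `equivalentproblems`. Here `‖x‖ = ∑' i, |x i|` and `‖x‖_∞ = ⨆ n, |x n|`. -/
theorem statement5 :
    List.TFAE
      [ ∀ (Γ : Type) [Uncountable Γ], Nonempty (↥(Ball Γ) ≃ₜ ↥(PosBall Γ)),
        ∃ Γ : Type, Uncountable Γ ∧ Nonempty (↥(Ball Γ) ≃ₜ ↥(PosBall Γ)),
        ∃ f : ↥(Ball ℕ) ≃ₜ ↥(PosBall ℕ), ∀ x y : ↥(Ball ℕ),
          (∑' n, |x.1 n|) < (∑' n, |y.1 n|) → (∑' n, |(f x).1 n|) < (∑' n, |(f y).1 n|),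
        ∃ f : ↥(Ball ℕ) ≃ₜ ↥(PosBall ℕ), ∀ x : ↥(Ball ℕ),
          (∑' n, |(f x).1 n|) = ∑' n, |x.1 n|,
        ∃ f : (ℕ → Set.Icc (-1:ℝ) 1) ≃ₜ (ℕ → Set.Icc (0:ℝ) 1),
          ∀ x : ℕ → Set.Icc (-1:ℝ) 1, (⨆ n, |(f x n : ℝ)|) = ⨆ n, |(x n : ℝ)| ] := by
  tfae_have 1 → 2 := fun h => ⟨ℝ, inferInstance, h ℝ⟩
  tfae_have 2 → 3 := imp23
  tfae_have 3 → 4 := imp34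
  tfae_have 4 → 1 := fun h Γ _ => imp41 h Γ
  obtain ⟨Φ, hΦ⟩ := exists_ball_homeo
  obtain ⟨Ψ, hΨ⟩ := exists_posBall_homeo
  tfae_have 4 → 5 := by
    rintro ⟨f, hf⟩
    refine ⟨Φ.symm.trans (f.trans Ψ), fun x => ?_⟩
    change (⨆ n, |(Ψ (f (Φ.symm x)) n : ℝ)|) = _
    rw [hΨ, hf, ← hΦ, Φ.apply_symm_apply]
  tfae_have 5 → 4 := by
    rintro ⟨f, hf⟩
    refine ⟨Φ.trans (f.trans Ψ.symm), fun x => ?_⟩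
    change ∑' n, |(Ψ.symm (f (Φ x))).1 n| = _
    rw [← hΨ, Ψ.apply_symm_apply, hf, hΦ]
  tfae_finish

end
end

section
/- There exists a homeomorphism f : [-1,1]^ℕ → B(ℕ) (where [-1,1]^ℕ carries the product topology) such that f([0,1]^ℕ) = B⁺(ℕ) and ∑_{n∈ℕ} |f(x)_n| = sup_{n∈ℕ} |x_n| for every x ∈ [-1,1]^ℕ. -/
open Set Filter Topology

noncomputable section

/-- one-dimensional signed step -/
def vv (e m x : ℝ) : ℝ := x - (1 - e) * max (-m) (min m x)
/-- contraction factor -/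
def cc (e m x : ℝ) : ℝ := 1 - e * min 1 (|x| / m)
/-- reconstruct the factor from the image -/
def kk (e s a : ℝ) : ℝ := if s = 0 then 1 else max (1 - e) (s / (s + a))

lemma vv_cases {e m x : ℝ} (hm : 0 ≤ m) :
    (m ≤ x ∧ vv e m x = x - (1 - e) * m) ∨ (x ≤ -m ∧ vv e m x = x + (1 - e) * m) ∨
    (-m ≤ x ∧ x ≤ m ∧ vv e m x = e * x) := by
  unfold vv
  rcases le_total m x with h | h
  · left
    rw [min_eq_left h, max_eq_right (by linarith)]
    exact ⟨h, rfl⟩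
  · right
    rw [min_eq_right h]
    rcases le_total x (-m) with h' | h'
    · left
      rw [max_eq_left h']
      exact ⟨h', by ring⟩
    · right
      rw [max_eq_right h']
      exact ⟨h', h, by ring⟩

lemma cc_zero (e x : ℝ) : cc e 0 x = 1 := by simp [cc]

lemma cc_mul {e m x : ℝ} (hm : 0 ≤ m) : cc e m x * m = m - e * min m |x| := by
  unfold cc
  rcases hm.eq_or_lt with h | h
  · subst h; simp
  · have : min 1 (|x| / m) * m = min m |x| := by
      rw [min_mul_of_nonneg _ _ hm, one_mul, div_mul_cancel₀ _ h.ne']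
    rw [← this]; ring

lemma abs_vv {e m x : ℝ} (he : 0 < e) (he1 : e < 1) (hm : 0 ≤ m) :
    |vv e m x| = max m |x| - m + e * min m |x| := by
  rcases vv_cases (e := e) (x := x) hm with ⟨h, h2⟩ | ⟨h, h2⟩ | ⟨h, h1, h2⟩
  · rw [h2, abs_of_nonneg (by nlinarith : 0 ≤ x), abs_of_nonneg (by nlinarith), max_eq_right h,
      min_eq_left h]
    ring
  · rw [h2, abs_of_nonpos (by nlinarith : x ≤ 0), abs_of_nonpos (by nlinarith),
      max_eq_right (by linarith), min_eq_left (by linarith)]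
    ring
  · have : |x| ≤ m := abs_le.2 ⟨h, h1⟩
    rw [h2, abs_mul, abs_of_pos he, max_eq_left this, min_eq_right this]
    ring

lemma abs_vv_add {e m x : ℝ} (he : 0 < e) (he1 : e < 1) (hm : 0 ≤ m) :
    |vv e m x| + cc e m x * m = max m |x| := by
  rw [abs_vv he he1 hm, cc_mul hm]; ring

lemma vv_strictMono {e m : ℝ} (he : 0 < e) (he1 : e < 1) (hm : 0 ≤ m) :
    StrictMono (vv e m) := by
  intro x z h
  rcases vv_cases (e := e) (x := x) hm with ⟨h1, h2⟩ | ⟨h1, h2⟩ | ⟨h1, h1', h2⟩ <;>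
  rcases vv_cases (e := e) (x := z) hm with ⟨h3, h4⟩ | ⟨h3, h4⟩ | ⟨h3, h3', h4⟩ <;>
  rw [h2, h4] <;> nlinarith

lemma vv_zero {e m : ℝ} (hm : 0 ≤ m) : vv e m 0 = 0 := by
  simp [vv, hm]

lemma vv_nonneg_iff {e m x : ℝ} (he : 0 < e) (he1 : e < 1) (hm : 0 ≤ m) :
    0 ≤ vv e m x ↔ 0 ≤ x := by
  have := (vv_strictMono he he1 hm).le_iff_le (a := 0) (b := x)
  rwa [vv_zero hm] at this

lemma abs_vv_le {e m x : ℝ} (he : 0 < e) (he1 : e < 1) (hm : 0 ≤ m) : |vv e m x| ≤ |x| := by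
  rw [abs_vv he he1 hm]
  rcases le_total m |x| with h | h
  · rw [max_eq_right h, min_eq_left h]; nlinarith
  · rw [max_eq_left h, min_eq_right h]; nlinarith [abs_nonneg x]

lemma vv_surj {e m : ℝ} (he : 0 < e) (he1 : e < 1) (hm : 0 ≤ m) (w : ℝ) :
    ∃ x, vv e m x = w := by
  have hc : Continuous (vv e m) := by unfold vv; fun_prop
  have h1 : vv e m (|w| + m) ≥ w := by
    rcases vv_cases (e := e) (x := |w| + m) hm with ⟨h1, h2⟩ | ⟨h1, h2⟩ | ⟨h1, h1', h2⟩
    all_goals nlinarith [abs_nonneg w, le_abs_self w]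
  have h2 : vv e m (-(|w| + m)) ≤ w := by
    rcases vv_cases (e := e) (x := -(|w| + m)) hm with ⟨h1, h2⟩ | ⟨h1, h2⟩ | ⟨h1, h1', h2⟩
    all_goals nlinarith [abs_nonneg w, neg_abs_le w]
  obtain ⟨x, -, hx⟩ := intermediate_value_Icc (by linarith [abs_nonneg w] : -(|w| + m) ≤ |w| + m)
    hc.continuousOn ⟨h2, h1⟩
  exact ⟨x, hx⟩

lemma cc_eq {e m x : ℝ} (he : 0 < e) (he1 : e < 1) (hm : 0 < m) :
    cc e m x = max (1 - e) (1 - |vv e m x| / m) := by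
  have h1 := cc_mul (e := e) (x := x) hm.le
  have h2 : max (1 - e) (1 - |vv e m x| / m) * m = max ((1 - e) * m) (m - |vv e m x|) := by
    rw [max_mul_of_nonneg _ _ hm.le]; congr 1; field_simp
  apply mul_right_cancel₀ hm.ne'
  rw [h1, h2, abs_vv he he1 hm.le]
  rcases le_total m |x| with h | h
  · rw [max_eq_right h, min_eq_left h, max_eq_left (by nlinarith)]; ring
  · rw [max_eq_left h, min_eq_right h, max_eq_right (by nlinarith)]; ring

lemma cc_bounds {e m x : ℝ} (he : 0 < e) (hm : 0 ≤ m) : 1 - e ≤ cc e m x ∧ cc e m x ≤ 1 := by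
  have h1 : 0 ≤ min 1 (|x| / m) := by positivity
  have h2 : min 1 (|x| / m) ≤ 1 := min_le_left _ _
  unfold cc
  constructor <;> nlinarith

lemma kk_bounds {e s a : ℝ} (he : 0 < e) (hs : 0 ≤ s) (ha : 0 ≤ a) :
    1 - e ≤ kk e s a ∧ kk e s a ≤ 1 := by
  unfold kk
  split_ifs
  · constructor <;> linarith
  · exact ⟨le_max_left _ _, max_le (by linarith) (div_le_one_of_le₀ (by linarith) (by linarith))⟩

lemma kk_iff {e s a c : ℝ} (hs : 0 < s) (ha : 0 ≤ a) (hc : 0 < c) :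
    c = max (1 - e) (1 - a * c / s) ↔ c = kk e s a := by
  have hsa : 0 < s + a := by linarith
  rw [kk, if_neg hs.ne']
  have key : c - (1 - a * c / s) = (s + a) / s * (c - s / (s + a)) := by
    field_simp; ring
  have hp : 0 < (s + a) / s := by positivity
  generalize 1 - a * c / s = p at *
  generalize s / (s + a) = q at *
  have k1 : p ≤ c ↔ q ≤ c := by
    rw [← sub_nonneg, key, mul_nonneg_iff_of_pos_left hp, sub_nonneg]
  have k2 : c = p ↔ c = q := by
    rw [← sub_eq_zero, key, mul_eq_zero, sub_eq_zero]; simp [hp.ne']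
  constructor <;> intro h
  · rcases max_choice (1 - e) p with h' | h'
    · rw [h'] at h
      rw [max_eq_left]; exact h
      rw [← h, ← k1, h, ← h']; exact le_max_right _ _
    · rw [h'] at h
      rw [← k2.1 h, max_eq_right]; rw [h, ← h']; exact le_max_left _ _
  · rcases max_choice (1 - e) q with h' | h'
    · rw [h'] at h
      rw [max_eq_left]; exact h
      rw [← h, k1, h, ← h']; exact le_max_right _ _
    · rw [h'] at h
      rw [← k2.2 h, max_eq_right]; rw [h, ← h']; exact le_max_left _ _

/-- weights -/
def ep (n : ℕ) : ℝ := (1 / 2) ^ (n + 2)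

lemma ep_pos (n : ℕ) : 0 < ep n := by unfold ep; positivity
lemma ep_lt (n : ℕ) : ep n < 1 := pow_lt_one₀ (by norm_num) (by norm_num) (by omega)

/-- partial product -/
def pp (c : ℕ → ℝ) (n K : ℕ) : ℝ := ∏ k ∈ Finset.range K, c (n + k)
/-- tail product -/
def tl (c : ℕ → ℝ) (n : ℕ) : ℝ := ⨅ K, pp c n K

/-- admissible factors -/
def Adm (c : ℕ → ℝ) : Prop := ∀ k, 1 - ep k ≤ c k ∧ c k ≤ 1

lemma Adm.pos {c : ℕ → ℝ} (h : Adm c) (k : ℕ) : 0 < c k := by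
  have := ep_lt k; have := (h k).1; linarith

lemma pp_nonneg {c : ℕ → ℝ} (h : Adm c) (n K : ℕ) : 0 ≤ pp c n K :=
  Finset.prod_nonneg fun k _ => (h.pos _).le

lemma pp_succ (c : ℕ → ℝ) (n K : ℕ) : pp c n (K + 1) = pp c n K * c (n + K) :=
  Finset.prod_range_succ _ _

lemma pp_succ' (c : ℕ → ℝ) (n K : ℕ) : pp c n (K + 1) = c n * pp c (n + 1) K := by
  unfold pp
  rw [Finset.prod_range_succ', mul_comm]
  simp only [add_zero]
  congr 1
  exact Finset.prod_congr rfl fun k _ => congrArg c (by omega)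

lemma pp_le_one {c : ℕ → ℝ} (h : Adm c) (n K : ℕ) : pp c n K ≤ 1 :=
  Finset.prod_le_one (fun k _ => (h.pos _).le) fun k _ => (h _).2

lemma pp_lower {c : ℕ → ℝ} (h : Adm c) (n K : ℕ) :
    1 - (1 / 2 : ℝ) ^ (n + 1) + (1 / 2) ^ (n + 1 + K) ≤ pp c n K := by
  induction K with
  | zero => simp [pp]
  | succ K ih =>
    rw [pp_succ]
    have h1 := (h (n + K)).1
    have h2 := pp_le_one h n K
    have h3 := pp_nonneg h n K
    have h4 := ep_pos (n + K)
    have h5 : (1 / 2 : ℝ) ^ (n + 1 + (K + 1)) = (1 / 2) ^ (n + 1 + K) - ep (n + K) := by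
      unfold ep; ring
    rw [h5]
    nlinarith

lemma tl_tendsto {c : ℕ → ℝ} (h : Adm c) (n : ℕ) : Tendsto (pp c n) atTop (𝓝 (tl c n)) := by
  apply tendsto_atTop_ciInf
  · apply antitone_nat_of_succ_le
    intro K
    rw [pp_succ]
    exact mul_le_of_le_one_right (pp_nonneg h n K) (h _).2
  · exact ⟨0, by rintro _ ⟨K, rfl⟩; exact pp_nonneg h n K⟩

lemma tl_lower {c : ℕ → ℝ} (h : Adm c) (n : ℕ) : 1 - (1 / 2 : ℝ) ^ (n + 1) ≤ tl c n := by
  apply ge_of_tendsto' (tl_tendsto h n)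
  intro K
  have := pp_lower h n K
  have : (0 : ℝ) < (1 / 2) ^ (n + 1 + K) := by positivity
  linarith

lemma tl_pos {c : ℕ → ℝ} (h : Adm c) (n : ℕ) : 0 < tl c n := by
  have := tl_lower h n
  have : (1 / 2 : ℝ) ^ (n + 1) < 1 := pow_lt_one₀ (by norm_num) (by norm_num) (by omega)
  linarith

lemma tl_le_one {c : ℕ → ℝ} (h : Adm c) (n : ℕ) : tl c n ≤ 1 :=
  le_of_tendsto' (tl_tendsto h n) (pp_le_one h n)

lemma tl_succ {c : ℕ → ℝ} (h : Adm c) (n : ℕ) : tl c n = c n * tl c (n + 1) := by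
  have h1 := (tl_tendsto h n).comp (tendsto_add_atTop_nat 1)
  have h2 := (tl_tendsto h (n + 1)).const_mul (c n)
  refine tendsto_nhds_unique h1 (h2.congr fun K => ?_)
  simp [pp_succ']

lemma tl_pp {c : ℕ → ℝ} (h : Adm c) (n K : ℕ) : tl c n = pp c n K * tl c (n + K) := by
  induction K with
  | zero => simp [pp]
  | succ K ih => rw [ih, pp_succ, tl_succ h (n + K)]; ring_nf

lemma tl_tendsto_one {c : ℕ → ℝ} (h : Adm c) : Tendsto (tl c) atTop (𝓝 1) := by
  refine tendsto_of_tendsto_of_tendsto_of_le_of_le (g := fun n => 1 - (1 / 2 : ℝ) ^ (n + 1)) ?_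
    tendsto_const_nhds (tl_lower h) (tl_le_one h)
  have := (tendsto_pow_atTop_nhds_zero_of_lt_one (r := (1 / 2 : ℝ)) (by norm_num)
    (by norm_num)).comp (tendsto_add_atTop_nat 1)
  simpa using this.const_sub 1

/-- running maximum -/
def mm (x : ℕ → ℝ) : ℕ → ℝ
  | 0 => 0
  | n + 1 => max (mm x n) |x n|

/-- factors of x -/
def cx (x : ℕ → ℝ) (n : ℕ) : ℝ := cc (ep n) (mm x n) (x n)

/-- the map -/
def ff (x : ℕ → ℝ) (n : ℕ) : ℝ := vv (ep n) (mm x n) (x n) * tl (cx x) (n + 1)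

/-- partial sums -/
def ss (y : ℕ → ℝ) (n : ℕ) : ℝ := ∑ i ∈ Finset.range n, |y i|

lemma mm_nonneg (x : ℕ → ℝ) (n : ℕ) : 0 ≤ mm x n := by
  cases n with
  | zero => exact le_rfl
  | succ n => exact (abs_nonneg _).trans (le_max_right _ _)

lemma mm_mono (x : ℕ → ℝ) : Monotone (mm x) := monotone_nat_of_le_succ fun _ => le_max_left _ _

lemma le_mm (x : ℕ → ℝ) {n k : ℕ} (h : n < k) : |x n| ≤ mm x k :=
  (le_max_right _ _).trans (mm_mono x (Nat.succ_le_of_lt h))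

lemma mm_le {x : ℕ → ℝ} {r : ℝ} (hr : 0 ≤ r) (h : ∀ n, |x n| ≤ r) (n : ℕ) : mm x n ≤ r := by
  induction n with
  | zero => exact hr
  | succ n ih => exact max_le ih (h n)

lemma adm_cx (x : ℕ → ℝ) : Adm (cx x) := fun k => cc_bounds (ep_pos k) (mm_nonneg x k)

lemma ss_nonneg (y : ℕ → ℝ) (n : ℕ) : 0 ≤ ss y n := Finset.sum_nonneg fun _ _ => abs_nonneg _

lemma ss_succ (y : ℕ → ℝ) (n : ℕ) : ss y (n + 1) = ss y n + |y n| := Finset.sum_range_succ _ _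

lemma ss_ff (x : ℕ → ℝ) (n : ℕ) : ss (ff x) n = tl (cx x) n * mm x n := by
  induction n with
  | zero => simp [ss, mm]
  | succ n ih =>
    rw [ss_succ, ih, tl_succ (adm_cx x) n, mm,
      ← abs_vv_add (ep_pos n) (ep_lt n) (mm_nonneg x n), ff, abs_mul,
      abs_of_pos (tl_pos (adm_cx x) _), cx]
    ring

lemma mm_tendsto {x : ℕ → ℝ} (h : ∀ n, |x n| ≤ 1) : Tendsto (mm x) atTop (𝓝 (⨆ n, |x n|)) := by
  have hb : BddAbove (range fun n => |x n|) := ⟨1, by rintro _ ⟨n, rfl⟩; exact h n⟩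
  have hs : 0 ≤ ⨆ n, |x n| := (abs_nonneg _).trans (le_ciSup hb 0)
  apply tendsto_atTop_isLUB (mm_mono x)
  constructor
  · rintro _ ⟨n, rfl⟩
    exact mm_le hs (fun k => le_ciSup hb k) n
  · intro b hb'
    exact ciSup_le fun n => (le_mm x (Nat.lt_succ_self n)).trans (hb' ⟨n + 1, rfl⟩)

lemma ff_hasSum {x : ℕ → ℝ} (h : ∀ n, |x n| ≤ 1) : HasSum (fun n => |ff x n|) (⨆ n, |x n|) := by
  rw [hasSum_iff_tendsto_nat_of_nonneg (fun _ => abs_nonneg _)]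
  have := (tl_tendsto_one (adm_cx x)).mul (mm_tendsto h)
  rw [one_mul] at this
  exact this.congr fun n => (ss_ff x n).symm

lemma ff_mem {x : ℕ → ℝ} (h : ∀ n, |x n| ≤ 1) : ff x ∈ Ball ℕ := by
  intro s
  exact (sum_le_hasSum s (fun _ _ => abs_nonneg _) (ff_hasSum h)).trans (ciSup_le h)

lemma ff_nonneg_iff (x : ℕ → ℝ) (n : ℕ) : 0 ≤ ff x n ↔ 0 ≤ x n := by
  rw [ff, mul_nonneg_iff_of_pos_right (tl_pos (adm_cx x) _),
    vv_nonneg_iff (ep_pos n) (ep_lt n) (mm_nonneg x n)]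

lemma cx_eq (x : ℕ → ℝ) (n : ℕ) : cx x n = kk (ep n) (ss (ff x) n) |ff x n| := by
  have hA := adm_cx x
  have ht := tl_pos hA (n + 1)
  have hc := hA.pos n
  rcases (mm_nonneg x n).eq_or_lt with h | h
  · rw [cx, ← h, cc_zero, kk, if_pos]
    rw [ss_ff, ← h, mul_zero]
  · rw [← kk_iff (by rw [ss_ff]; exact mul_pos (tl_pos hA n) h) (abs_nonneg _) hc]
    have h1 := cc_eq (x := x n) (ep_pos n) (ep_lt n) h
    have h2 : |ff x n| * cx x n / ss (ff x) n = |vv (ep n) (mm x n) (x n)| / mm x n := by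
      rw [ss_ff, tl_succ hA n, ff, abs_mul, abs_of_pos ht]
      field_simp
    rw [h2]; exact h1

lemma ff_inj {x z : ℕ → ℝ} (h : ff x = ff z) : x = z := by
  have hc : cx x = cx z := by
    funext n; rw [cx_eq, cx_eq, h]
  have hm : ∀ n, mm x n = mm z n := by
    intro n
    have h1 := ss_ff x n
    rw [h, ss_ff z n, hc] at h1
    exact (mul_left_cancel₀ (tl_pos (adm_cx z) n).ne' h1).symm
  funext n
  have h1 := congrFun h n
  rw [ff, ff, hc, hm] at h1
  exact (vv_strictMono (ep_pos n) (ep_lt n) (mm_nonneg z n)).injective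
    (mul_right_cancel₀ (tl_pos (adm_cx z) _).ne' h1)

lemma ff_surj {y : ℕ → ℝ} (hy : y ∈ Ball ℕ) : ∃ x, (∀ n, |x n| ≤ 1) ∧ ff x = y := by
  set c : ℕ → ℝ := fun n => kk (ep n) (ss y n) |y n| with hcdef
  have hA : Adm c := fun n => kk_bounds (ep_pos n) (ss_nonneg y n) (abs_nonneg _)
  set m : ℕ → ℝ := fun n => ss y n / tl c n with hmdef
  have hm0 : ∀ n, 0 ≤ m n := fun n => div_nonneg (ss_nonneg y n) (tl_pos hA n).le
  choose x hx using fun n => vv_surj (ep_pos n) (ep_lt n) (hm0 n) (y n / tl c (n + 1))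
  have hcc : ∀ n, cc (ep n) (m n) (x n) = c n := by
    intro n
    rcases (ss_nonneg y n).eq_or_lt with h | h
    · simp only [hmdef, hcdef, ← h, zero_div, cc_zero, kk, if_true]
    · have hmp : 0 < m n := div_pos h (tl_pos hA n)
      rw [cc_eq (ep_pos n) (ep_lt n) hmp, hx]
      have h1 := (kk_iff (e := ep n) (c := c n) h (abs_nonneg (y n)) (hA.pos n)).2 rfl
      have ht := tl_pos hA (n + 1)
      have hcn := hA.pos n
      have h2 : |y n / tl c (n + 1)| / m n = |y n| * c n / ss y n := by
        simp only [hmdef]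
        rw [tl_succ hA n, abs_div, abs_of_pos ht]
        field_simp
      rw [h2]; exact h1.symm
  have hmax : ∀ n, m (n + 1) = max (m n) |x n| := by
    intro n
    have ht := tl_pos hA (n + 1)
    have hcn := hA.pos n
    rw [← abs_vv_add (ep_pos n) (ep_lt n) (hm0 n), hcc, hx, abs_div, abs_of_pos ht]
    simp only [hmdef]
    rw [tl_succ hA n, ss_succ]
    field_simp
    ring
  have hmm : ∀ n, mm x n = m n := by
    intro n
    induction n with
    | zero => simp [mm, hmdef, ss]
    | succ n ih => rw [mm, ih, hmax]
  have hcx : cx x = c := by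
    funext n; rw [cx, hmm, hcc]
  refine ⟨x, fun n => ?_, ?_⟩
  · refine (le_mm x (Nat.lt_succ_self n)).trans ?_
    have h1 : Tendsto (fun k => (tl c k)⁻¹) atTop (𝓝 1) := by
      simpa using (tl_tendsto_one hA).inv₀ one_ne_zero
    refine ge_of_tendsto h1 ?_
    filter_upwards [eventually_ge_atTop (n + 1)] with k hk
    refine (mm_mono x hk).trans ?_
    rw [hmm, ← one_div]
    exact div_le_div_of_nonneg_right (hy _) (tl_pos hA k).le
  · funext n
    rw [ff, hmm, hcx, hx, div_mul_cancel₀ _ (tl_pos hA _).ne']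

lemma mm_cont (n : ℕ) : Continuous fun x : ℕ → ℝ => mm x n := by
  induction n with
  | zero => exact continuous_const
  | succ n ih => exact ih.max (continuous_apply n).abs

lemma part_abs (n K : ℕ) (x : ℕ → ℝ) :
    |vv (ep n) (mm x n) (x n) * pp (cx x) (n + 1) K| ≤ |x n| := by
  rw [abs_mul, abs_of_nonneg (pp_nonneg (adm_cx x) _ _)]
  exact (mul_le_of_le_one_right (abs_nonneg _) (pp_le_one (adm_cx x) _ _)).trans
    (abs_vv_le (ep_pos n) (ep_lt n) (mm_nonneg x n))

lemma part_cont (n K : ℕ) :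
    Continuous fun x : ℕ → ℝ => vv (ep n) (mm x n) (x n) * pp (cx x) (n + 1) K := by
  induction K with
  | zero =>
    have := mm_cont n
    simp only [pp, Finset.range_zero, Finset.prod_empty, mul_one, vv]
    fun_prop
  | succ K ih =>
    rw [continuous_iff_continuousAt]
    intro x
    have hk := mm_cont (n + 1 + K)
    rcases (mm_nonneg x (n + 1 + K)).eq_or_lt with h | h
    · have hx : x n = 0 := by
        have := le_mm x (show n < n + 1 + K by omega)
        rw [← h] at this
        exact abs_nonpos_iff.1 this
      have h0 : vv (ep n) (mm x n) (x n) * pp (cx x) (n + 1) (K + 1) = 0 := by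
        rw [hx, vv_zero (mm_nonneg x n), zero_mul]
      rw [ContinuousAt, h0]
      refine squeeze_zero_norm (a := fun z : ℕ → ℝ => |z n|)
        (fun z => part_abs n (K + 1) z) ?_
      have := ((continuous_apply n).abs : Continuous fun z : ℕ → ℝ => |z n|).tendsto x
      simpa [hx] using this
    · simp only [pp_succ, ← mul_assoc]
      refine ih.continuousAt.mul ?_
      unfold cx cc
      refine continuousAt_const.sub (continuousAt_const.mul (continuousAt_const.min ?_))
      exact (continuous_apply _).abs.continuousAt.div hk.continuousAt h.ne'

lemma ff_cont : Continuous fun x : ℕ → Set.Icc (-1 : ℝ) 1 => ff (fun n => (x n : ℝ)) := by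
  refine continuous_pi fun n => ?_
  have hu : TendstoUniformly (fun (K : ℕ) (x : ℕ → Set.Icc (-1 : ℝ) 1) =>
      vv (ep n) (mm (fun n => (x n : ℝ)) n) (x n) * pp (cx (fun n => (x n : ℝ))) (n + 1) K)
      (fun x => ff (fun n => (x n : ℝ)) n) atTop := by
    rw [Metric.tendstoUniformly_iff]
    intro r hr
    have h1 : Tendsto (fun K : ℕ => (1 / 2 : ℝ) ^ (n + 1 + K + 1)) atTop (𝓝 0) :=
      (tendsto_pow_atTop_nhds_zero_of_lt_one (by norm_num) (by norm_num)).comp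
        (tendsto_atTop_mono (fun K => by simp only [id]; omega) tendsto_id)
    filter_upwards [h1.eventually_lt_const hr] with K hK x
    set z : ℕ → ℝ := fun n => (x n : ℝ) with hz
    refine lt_of_le_of_lt ?_ hK
    have hA := adm_cx z
    have hz1 : |z n| ≤ 1 := abs_le.2 ⟨(x n).2.1, (x n).2.2⟩
    have hp := part_abs n K z
    have h2 := tl_lower hA (n + 1 + K)
    have h3 := tl_le_one hA (n + 1 + K)
    rw [Real.dist_eq, ff, tl_pp hA (n + 1) K]
    change |_ - vv (ep n) (mm z n) (z n) * _| ≤ _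
    have h4 : vv (ep n) (mm z n) (z n) * (pp (cx z) (n + 1) K * tl (cx z) (n + 1 + K)) -
        vv (ep n) (mm z n) (z n) * pp (cx z) (n + 1) K =
        - (vv (ep n) (mm z n) (z n) * pp (cx z) (n + 1) K * (1 - tl (cx z) (n + 1 + K))) := by
      ring
    rw [h4, abs_neg, abs_mul, abs_of_nonneg (sub_nonneg.2 h3)]
    have h5 := mul_le_of_le_one_left (sub_nonneg.2 h3) (hp.trans hz1)
    linarith
  refine hu.continuous (Frequently.of_forall fun K => ?_)
  exact (part_cont n K).comp
    (continuous_pi fun k => continuous_subtype_val.comp (continuous_apply k))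

/-- consequence of Dijkstra–van Mill: there is a homeomorphism
`f : [-1,1]^ℕ → B(ℕ)` with `f([0,1]^ℕ) = B⁺(ℕ)` and `∑_n |f(x)_n| = sup_n |x_n|`. -/
theorem statement8 :
    ∃ f : (ℕ → Set.Icc (-1:ℝ) 1) ≃ₜ ↥(Ball ℕ),
      (⇑f '' {x : ℕ → Set.Icc (-1:ℝ) 1 | ∀ n, (0:ℝ) ≤ (x n : ℝ)} =
        {y : ↥(Ball ℕ) | y.1 ∈ PosBall ℕ}) ∧
      ∀ x : ℕ → Set.Icc (-1:ℝ) 1, (∑' n, |(f x).1 n|) = ⨆ n, |(x n : ℝ)| := by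
  have hx : ∀ x : ℕ → Set.Icc (-1:ℝ) 1, ∀ n, |(x n : ℝ)| ≤ 1 := fun x n => abs_le.2 (x n).2
  let F : (ℕ → Set.Icc (-1:ℝ) 1) → ↥(Ball ℕ) := fun x => ⟨ff fun n => (x n : ℝ), ff_mem (hx x)⟩
  have hF : Continuous F := ff_cont.subtype_mk _
  have hinj : Function.Injective F := by
    intro x z h
    have := ff_inj (congrArg Subtype.val h)
    funext n
    exact Subtype.ext (congrFun this n)
  have hsurj : Function.Surjective F := by
    intro y
    obtain ⟨x, h1, h2⟩ := ff_surj y.2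
    exact ⟨fun n => ⟨x n, abs_le.1 (h1 n)⟩, Subtype.ext h2⟩
  let f := Continuous.homeoOfEquivCompactToT2 (f := Equiv.ofBijective F ⟨hinj, hsurj⟩) hF
  have hf : ∀ x, f x = F x := fun _ => rfl
  refine ⟨f, ?_, fun x => ?_⟩
  · ext y
    constructor
    · rintro ⟨x, h, rfl⟩
      exact ⟨(f x).2, fun n => (ff_nonneg_iff _ n).2 (h n)⟩
    · intro h
      obtain ⟨x, rfl⟩ := hsurj y
      exact ⟨x, fun n => (ff_nonneg_iff _ n).1 (h.2 n), rfl⟩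
  · exact (ff_hasSum (hx x)).tsum_eq
end
end

section
/- (Pełczyński's decomposition method) Let X and Y be Banach spaces. Suppose that X is isomorphic to a complemented subspace of Y and Y is isomorphic to a complemented subspace of X. Suppose also that X is isomorphic to c₀(X), the c₀-sum of countably many copies of X. Then X and Y are isomorphic. -/
open Set Filter Topology

noncomputable section

/-- A null sequence as an element of `C₀(ℕ, A)`. -/
def c0mk {A : Type*} [NormedAddCommGroup A] (f : ℕ → A) (h : Tendsto f atTop (𝓝 0)) :
    ZeroAtInftyContinuousMap ℕ A where
  toFun := f
  continuous_toFun := continuous_of_discreteTopology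
  zero_at_infty' := by
    rw [cocompact_eq_cofinite, Nat.cofinite_eq_atTop]; exact h

theorem c0mk_apply {A : Type*} [NormedAddCommGroup A] (f : ℕ → A) (h : Tendsto f atTop (𝓝 0))
    (n : ℕ) : c0mk f h n = f n := rfl

theorem c0_tendsto {A : Type*} [NormedAddCommGroup A] (f : ZeroAtInftyContinuousMap ℕ A) :
    Tendsto f atTop (𝓝 0) := by
  have := f.zero_at_infty'
  rw [cocompact_eq_cofinite, Nat.cofinite_eq_atTop] at this; exact this

theorem c0_apply_le {A : Type*} [NormedAddCommGroup A] (f : ZeroAtInftyContinuousMap ℕ A)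
    (n : ℕ) : ‖f n‖ ≤ ‖f‖ := by
  rw [← ZeroAtInftyContinuousMap.norm_toBCF_eq_norm]
  exact f.toBCF.norm_coe_le_norm n

theorem c0_norm_le {A : Type*} [NormedAddCommGroup A] (f : ZeroAtInftyContinuousMap ℕ A)
    {C : ℝ} (hC : 0 ≤ C) (h : ∀ n, ‖f n‖ ≤ C) : ‖f‖ ≤ C := by
  rw [← ZeroAtInftyContinuousMap.norm_toBCF_eq_norm]
  exact (BoundedContinuousFunction.norm_le hC).2 h

section
variable {A B C : Type*} [NormedAddCommGroup A] [NormedSpace ℝ A]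
  [NormedAddCommGroup B] [NormedSpace ℝ B] [NormedAddCommGroup C] [NormedSpace ℝ C]

/-- Functoriality of the `c₀`-sum. -/
def c0map (T : A →L[ℝ] B) : ZeroAtInftyContinuousMap ℕ A →L[ℝ] ZeroAtInftyContinuousMap ℕ B :=
  LinearMap.mkContinuous
    { toFun := fun f => c0mk (fun n => T (f n))
        (by simpa [Function.comp_def] using (T.continuous.tendsto 0).comp (c0_tendsto f))
      map_add' := fun f g => by ext n; simp [c0mk_apply]
      map_smul' := fun c f => by ext n; simp [c0mk_apply] } ‖T‖ (fun f => by
        refine c0_norm_le _ (by positivity) fun n => ?_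
        exact (T.le_opNorm (f n)).trans (by gcongr; exact c0_apply_le f n))

theorem c0map_apply (T : A →L[ℝ] B) (f : ZeroAtInftyContinuousMap ℕ A) (n : ℕ) :
    c0map T f n = T (f n) := rfl

def c0congr (e : A ≃L[ℝ] B) :
    ZeroAtInftyContinuousMap ℕ A ≃L[ℝ] ZeroAtInftyContinuousMap ℕ B :=
  ContinuousLinearEquiv.equivOfInverse (c0map (e : A →L[ℝ] B)) (c0map (e.symm : B →L[ℝ] A))
    (fun f => by ext n; simp [c0map_apply]) (fun f => by ext n; simp [c0map_apply])

def c0prod : ZeroAtInftyContinuousMap ℕ (A × B) ≃L[ℝ]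
    ZeroAtInftyContinuousMap ℕ A × ZeroAtInftyContinuousMap ℕ B :=
  ContinuousLinearEquiv.equivOfInverse
    ((c0map (ContinuousLinearMap.fst ℝ A B)).prod (c0map (ContinuousLinearMap.snd ℝ A B)))
    ((c0map (ContinuousLinearMap.inl ℝ A B)).coprod (c0map (ContinuousLinearMap.inr ℝ A B)))
    (fun f => by ext n <;> simp [c0map_apply])
    (fun f => by
      refine Prod.ext ?_ ?_ <;> ext n <;> simp [c0map_apply])

def c0head : ZeroAtInftyContinuousMap ℕ A →L[ℝ] A :=
  LinearMap.mkContinuous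
    { toFun := fun f => f 0
      map_add' := fun f g => rfl
      map_smul' := fun c f => rfl } 1 (fun f => by simpa using c0_apply_le f 0)

def c0tail : ZeroAtInftyContinuousMap ℕ A →L[ℝ] ZeroAtInftyContinuousMap ℕ A :=
  LinearMap.mkContinuous
    { toFun := fun f => c0mk (fun n => f (n + 1)) ((c0_tendsto f).comp (tendsto_add_atTop_nat 1))
      map_add' := fun f g => rfl
      map_smul' := fun c f => rfl } 1 (fun f => by
        rw [one_mul]
        exact c0_norm_le _ (norm_nonneg _) fun n => c0_apply_le f (n + 1))

def consFun (a : A) (f : ℕ → A) : ℕ → A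
  | 0 => a
  | n + 1 => f n

def c0cons : A × ZeroAtInftyContinuousMap ℕ A →L[ℝ] ZeroAtInftyContinuousMap ℕ A :=
  LinearMap.mkContinuous
    { toFun := fun p => c0mk (consFun p.1 p.2)
        ((tendsto_add_atTop_iff_nat 1).1 (c0_tendsto p.2))
      map_add' := fun f g => by ext n; cases n <;> rfl
      map_smul' := fun c f => by ext n; cases n <;> rfl } 1 (fun p => by
        rw [one_mul]
        refine c0_norm_le _ (norm_nonneg _) fun n => ?_
        cases n with
        | zero => exact norm_fst_le p
        | succ n => exact (c0_apply_le p.2 n).trans (norm_snd_le p))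

def c0shift : ZeroAtInftyContinuousMap ℕ A ≃L[ℝ] A × ZeroAtInftyContinuousMap ℕ A :=
  ContinuousLinearEquiv.equivOfInverse (c0head.prod c0tail) c0cons
    (fun f => by ext n; cases n <;> rfl)
    (fun p => by refine Prod.ext rfl ?_; ext n; rfl)

/-- A complemented copy splits off. -/
def splitEquiv (i : A →L[ℝ] B) (r : B →L[ℝ] A) (h : r.comp i = ContinuousLinearMap.id ℝ A) :
    B ≃L[ℝ] A × r.ker :=
  have h' : ∀ a, r (i a) = a := fun a => by simpa using congrArg (fun T => T a) h
  ContinuousLinearEquiv.equivOfInverse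
    (r.prod ((ContinuousLinearMap.id ℝ B - i.comp r).codRestrict r.ker
      (fun b => by simp [h'])))
    (i.coprod r.ker.subtypeL)
    (fun b => by simp)
    (fun p => by
      have hp : r (p.2 : B) = 0 := p.2.2
      refine Prod.ext ?_ ?_
      · simp [h', hp]
      · ext; simp [h', hp])
end

/-- Pełczyński's decomposition method: if `X` is isomorphic to a
complemented subspace of `Y` (witnessed by operators `i : X → Y`, `r : Y → X` with
`r ∘ i = id`), `Y` is isomorphic to a complemented subspace of `X`, and `X` is
isomorphic to `c₀(X)` (modelled as `C₀(ℕ, X)`, the sequences in `X` tending to zero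
with the sup norm), then `X` and `Y` are isomorphic. -/
theorem statement12 {X Y : Type*}
    [NormedAddCommGroup X] [NormedSpace ℝ X] [CompleteSpace X]
    [NormedAddCommGroup Y] [NormedSpace ℝ Y] [CompleteSpace Y]
    (hXY : ∃ (i : X →L[ℝ] Y) (r : Y →L[ℝ] X), r.comp i = ContinuousLinearMap.id ℝ X)
    (hYX : ∃ (i : Y →L[ℝ] X) (r : X →L[ℝ] Y), r.comp i = ContinuousLinearMap.id ℝ Y)
    (hc0 : Nonempty (X ≃L[ℝ] ZeroAtInftyContinuousMap ℕ X)) :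
    Nonempty (X ≃L[ℝ] Y) := by
  obtain ⟨i, r, h⟩ := hXY
  obtain ⟨j, s, k⟩ := hYX
  obtain ⟨e⟩ := hc0
  have eY := splitEquiv i r h
  have eX := splitEquiv j s k
  have eXX : X ≃L[ℝ] X × X :=
    (e.trans c0shift).trans ((ContinuousLinearEquiv.refl ℝ X).prodCongr e.symm)
  have e1 : Y ≃L[ℝ] X × Y :=
    ((eY.trans (eXX.prodCongr (ContinuousLinearEquiv.refl ℝ _))).trans
      (ContinuousLinearEquiv.prodAssoc ℝ X X _)).trans
      ((ContinuousLinearEquiv.refl ℝ X).prodCongr eY.symm)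
  have e2 : X ≃L[ℝ] ZeroAtInftyContinuousMap ℕ Y × ZeroAtInftyContinuousMap ℕ s.ker :=
    (e.trans (c0congr eX)).trans c0prod
  have e3 : X ≃L[ℝ] Y × X :=
    ((e2.trans (c0shift.prodCongr (ContinuousLinearEquiv.refl ℝ _))).trans
      (ContinuousLinearEquiv.prodAssoc ℝ Y _ _)).trans
      ((ContinuousLinearEquiv.refl ℝ Y).prodCongr e2.symm)
  exact ⟨(e3.trans (ContinuousLinearEquiv.prodComm ℝ Y X)).trans e1.symm⟩

end
end

section
/- Let X be a real Banach space. Then X is weakly compactly generated if and only if the closed dual unit ball B_{X*}, equipped with the weak* topology, is affinely homeomorphic to a convex weakly compact subset of some real Banach space Y, i.e. there exist a real Banach space Y, a convex subset K of Y which is compact in the weak topology of Y, and a homeomorphism h : (B_{X*}, w*) → K (K with the weak topology) satisfying h(t x* + (1-t) y*) = t h(x*) + (1-t) h(y*) for all x*, y* ∈ B_{X*} and t ∈ [0,1]. -/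
open Set Filter Topology

noncomputable section

universe u

section
open scoped NNReal CompactlySupported

/-- The variation functional of `L` applied to a bound `f`. -/
noncomputable def varFun {K : Type*} [TopologicalSpace K] [CompactSpace K]
    (L : C(K, ℝ) →L[ℝ] ℝ) (f : K → ℝ) : ℝ :=
  sSup {r | ∃ g : C(K, ℝ), (∀ x, |g x| ≤ f x) ∧ L g = r}

section
variable {K : Type*} [TopologicalSpace K] [CompactSpace K] (L : C(K, ℝ) →L[ℝ] ℝ)

lemma varFun_bdd (f : C(K, ℝ≥0)) :
    BddAbove {r | ∃ g : C(K, ℝ), (∀ x, |g x| ≤ (f x : ℝ)) ∧ L g = r} := by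
  let F : C(K, ℝ) := ⟨fun x => (f x : ℝ), by fun_prop⟩
  refine ⟨‖L‖ * ‖F‖, ?_⟩
  rintro _ ⟨g, hg, rfl⟩
  refine (le_abs_self _).trans ((L.le_opNorm g).trans ?_)
  gcongr
  refine (ContinuousMap.norm_le _ (norm_nonneg _)).2 fun x => ?_
  refine (hg x).trans ((le_abs_self _).trans (F.norm_coe_le_norm x))

lemma le_varFun (f : C(K, ℝ≥0)) (g : C(K, ℝ)) (h : ∀ x, |g x| ≤ (f x : ℝ)) :
    L g ≤ varFun L (fun x => f x) :=
  le_csSup (varFun_bdd L f) ⟨g, h, rfl⟩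

lemma varFun_le (f : C(K, ℝ≥0)) (a : ℝ)
    (h : ∀ g : C(K, ℝ), (∀ x, |g x| ≤ (f x : ℝ)) → L g ≤ a) :
    varFun L (fun x => f x) ≤ a := by
  refine csSup_le ⟨L 0, 0, by simp, rfl⟩ ?_
  rintro _ ⟨g, hg, rfl⟩
  exact h g hg

lemma varFun_nonneg (f : C(K, ℝ≥0)) : 0 ≤ varFun L (fun x => f x) := by
  simpa using le_varFun L f 0 (by simp)

lemma varFun_add (f₁ f₂ : C(K, ℝ≥0)) :
    varFun L (fun x => (f₁ + f₂) x) = varFun L (fun x => f₁ x) + varFun L (fun x => f₂ x) := by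
  apply le_antisymm
  · refine varFun_le L (f₁ + f₂) _ fun g hg => ?_
    let g₁ : C(K, ℝ) := ⟨fun x => max (-(f₁ x : ℝ)) (min (g x) (f₁ x)), by fun_prop⟩
    have e : g = g₁ + (g - g₁) := by abel
    rw [e, map_add]
    refine add_le_add (le_varFun L f₁ _ fun x => ?_) (le_varFun L f₂ _ fun x => ?_)
    · change |max (-(f₁ x : ℝ)) (min (g x) (f₁ x))| ≤ _
      have := (f₁ x).2
      rw [abs_le]
      refine ⟨le_max_left _ _, max_le (by simp) (min_le_right _ _)⟩
    · change |g x - max (-(f₁ x : ℝ)) (min (g x) (f₁ x))| ≤ _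
      have h1 := NNReal.coe_nonneg (f₁ x)
      have h2 := NNReal.coe_nonneg (f₂ x)
      have h3 := hg x
      simp only [ContinuousMap.add_apply, NNReal.coe_add, abs_le] at h3
      obtain ⟨h3, h4⟩ := h3
      generalize ((f₁ x : ℝ≥0) : ℝ) = a at *
      generalize ((f₂ x : ℝ≥0) : ℝ) = b at *
      generalize g x = c at *
      rw [abs_le]
      rcases max_cases (-a) (min c a) with ⟨h, h'⟩ | ⟨h, h'⟩ <;>
        rcases min_cases c a with ⟨h5, h6⟩ | ⟨h5, h6⟩ <;> rw [h] <;> (try rw [h5]) <;>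
          rw [h5] at h' <;> constructor <;> linarith
  · rw [← le_sub_iff_add_le]
    refine varFun_le L f₁ _ fun g₁ h₁ => ?_
    rw [le_sub_comm]
    refine varFun_le L f₂ _ fun g₂ h₂ => ?_
    rw [le_sub_iff_add_le', ← map_add]
    refine le_varFun L _ _ fun x => ?_
    simp only [ContinuousMap.add_apply, NNReal.coe_add]
    exact (abs_add_le _ _).trans (add_le_add (h₁ x) (h₂ x))

lemma varFun_smul_le (c : ℝ≥0) (f : C(K, ℝ≥0)) :
    (c : ℝ) * varFun L (fun x => f x) ≤ varFun L (fun x => (c • f) x) := by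
  rcases eq_or_ne c 0 with rfl | hc
  · simpa using varFun_nonneg L ((0 : ℝ≥0) • f)
  have hc' : (0 : ℝ) < c := by positivity
  rw [← le_div_iff₀' hc']
  refine varFun_le L f _ fun g hg => ?_
  rw [le_div_iff₀' hc']
  have := le_varFun L (c • f) ((c : ℝ) • g) fun x => by
    simp only [ContinuousMap.smul_apply, smul_eq_mul, abs_mul, NNReal.coe_mul, NNReal.abs_eq]
    exact mul_le_mul_of_nonneg_left (hg x) hc'.le
  simpa using this

lemma varFun_smul (c : ℝ≥0) (f : C(K, ℝ≥0)) :
    varFun L (fun x => (c • f) x) = (c : ℝ) * varFun L (fun x => f x) := by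
  refine le_antisymm ?_ (varFun_smul_le L c f)
  rcases eq_or_ne c 0 with rfl | hc
  · simp only [NNReal.coe_zero, zero_mul]
    refine varFun_le L _ _ fun g hg => ?_
    have : g = 0 := by
      ext x
      simpa using hg x
    simp [this]
  have hc' : (0 : ℝ) < c := by positivity
  have := varFun_smul_le L c⁻¹ (c • f)
  rw [smul_smul, inv_mul_cancel₀ hc, one_smul, NNReal.coe_inv, inv_mul_le_iff₀ hc'] at this
  exact this

/-- The variation as an additive functional on nonnegative functions. -/
noncomputable def varLin : C_c(K, ℝ≥0) →ₗ[ℝ≥0] ℝ≥0 where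
  toFun f := ⟨varFun L (fun x => f.toContinuousMap x), varFun_nonneg L _⟩
  map_add' f g := by
    apply NNReal.eq
    exact varFun_add L f.toContinuousMap g.toContinuousMap
  map_smul' c f := by
    apply NNReal.eq
    exact varFun_smul L c f.toContinuousMap

lemma weak_conv [T2Space K] (f : ℕ → C(K, ℝ)) (f₀ : C(K, ℝ)) (M : ℝ) (hM : ∀ n, ‖f n‖ ≤ M)
    (h : ∀ x, Tendsto (fun n => f n x) atTop (𝓝 (f₀ x))) :
    Tendsto (fun n => L (f n)) atTop (𝓝 (L f₀)) := by
  borelize K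
  let μ := NNRealRMK.rieszMeasure (varLin L)
  let d : ℕ → C_c(K, ℝ≥0) := fun n =>
    ⟨⟨fun x => Real.toNNReal |f n x - f₀ x|, by fun_prop⟩, HasCompactSupport.of_compactSpace _⟩
  have hd : ∀ n x, ((d n x : ℝ≥0) : ℝ) = |f n x - f₀ x| := fun n x => by
    simp [d]
  have key : ∀ n, |L (f n) - L f₀| ≤ ∫ x, |f n x - f₀ x| ∂μ := by
    intro n
    have e : ∫ x, |f n x - f₀ x| ∂μ = varLin L (d n) := by
      rw [← NNRealRMK.integral_rieszMeasure]
      simp only [hd]; rfl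
    rw [e, ← map_sub, abs_le', ← map_neg]
    constructor
    · exact le_varFun L (d n).toContinuousMap _ fun x => (hd n x).ge
    · exact le_varFun L (d n).toContinuousMap _ fun x => by
        simpa [abs_sub_comm] using (hd n x).ge
  have lim : Tendsto (fun n => ∫ x, |f n x - f₀ x| ∂μ) atTop (𝓝 (∫ x, (0 : ℝ) ∂μ)) := by
    refine MeasureTheory.tendsto_integral_of_dominated_convergence (fun _ => M + ‖f₀‖) ?_ ?_ ?_ ?_
    · intro n
      exact (Continuous.aestronglyMeasurable (by fun_prop))
    · exact MeasureTheory.integrable_const _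
    · intro n
      refine Eventually.of_forall fun x => ?_
      rw [Real.norm_eq_abs, abs_abs]
      refine (abs_sub _ _).trans (add_le_add (((f n).norm_coe_le_norm x).trans (hM n)) (f₀.norm_coe_le_norm x))
    · refine Eventually.of_forall fun x => ?_
      have := ((h x).sub_const (f₀ x)).abs
      simpa using this
  rw [MeasureTheory.integral_zero] at lim
  rw [tendsto_iff_norm_sub_tendsto_zero]
  exact squeeze_zero (fun _ => norm_nonneg _) key lim

lemma count_tight {B : Type*} [TopologicalSpace B] (f : B → C(K, ℝ))
    (hf : ∀ k, Continuous fun b => f b k) (C : Set B) (b₀ : B) (hb : b₀ ∈ closure C) :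
    ∃ D ⊆ C, D.Countable ∧ ∀ n : ℕ, ∀ x : Fin n → K, ∃ c ∈ D, ∀ i,
      |f c (x i) - f b₀ (x i)| < 1 / ((n : ℝ) + 1) := by
  have step : ∀ n : ℕ, ∃ D ⊆ C, D.Countable ∧ ∀ x : Fin n → K, ∃ c ∈ D, ∀ i,
      |f c (x i) - f b₀ (x i)| < 1 / ((n : ℝ) + 1) := by
    intro n
    let U : C → Set (Fin n → K) := fun c =>
      ⋂ i, {x | |f c (x i) - f b₀ (x i)| < 1 / ((n : ℝ) + 1)}
    have hU : ∀ c, IsOpen (U c) := fun c =>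
      isOpen_iInter_of_finite fun i => isOpen_lt (by fun_prop) continuous_const
    have hcov : (univ : Set (Fin n → K)) ⊆ ⋃ c, U c := by
      intro x _
      have ho : IsOpen (⋂ i, {b : B | |f b (x i) - f b₀ (x i)| < 1 / ((n : ℝ) + 1)}) :=
        isOpen_iInter_of_finite fun i =>
          isOpen_lt (((hf (x i)).sub continuous_const).abs) continuous_const
      obtain ⟨c, hc, hcC⟩ := mem_closure_iff.1 hb _ ho (by
        simp only [mem_iInter, mem_ofPred_eq, sub_self, abs_zero]
        intro i; positivity)
      exact mem_iUnion.2 ⟨⟨c, hcC⟩, by simpa [U] using hc⟩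
    obtain ⟨t, ht⟩ := isCompact_univ.elim_finite_subcover U hU hcov
    refine ⟨(↑) '' (t : Set C), by simp, (t.finite_toSet.image _).countable, fun x => ?_⟩
    have := ht (mem_univ x)
    simp only [mem_iUnion] at this
    obtain ⟨c, hc, hx⟩ := this
    exact ⟨c, ⟨c, hc, rfl⟩, by simpa [U] using hx⟩
  choose D hD hc hx using step
  refine ⟨⋃ n, D n, iUnion_subset hD, countable_iUnion hc, fun n x => ?_⟩
  obtain ⟨c, h, h'⟩ := hx n x
  exact ⟨c, mem_iUnion.2 ⟨n, h⟩, h'⟩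

/-- Grothendieck: pointwise compactness gives weak compactness in `C(K)`. -/
lemma grothendieck [T2Space K] {B : Type*} [TopologicalSpace B] [CompactSpace B] (f : B → C(K, ℝ))
    (hf : ∀ k, Continuous fun b => f b k) (M : ℝ) (hM : ∀ b, ‖f b‖ ≤ M) :
    Continuous fun b => L (f b) := by
  rw [continuous_iff_continuousAt]
  intro b₀
  by_contra hcon
  obtain ⟨ε, hε, hcl⟩ : ∃ ε > 0, b₀ ∈ closure {b | ε ≤ |L (f b) - L (f b₀)|} := by
    by_contra! H
    apply hcon
    refine Metric.tendsto_nhds.2 fun ε hε => ?_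
    have := H ε hε
    rw [mem_closure_iff_frequently, not_frequently] at this
    filter_upwards [this] with b hb
    simpa [Real.dist_eq] using hb
  obtain ⟨D, hDC, hDc, hD⟩ := count_tight f hf _ b₀ hcl
  have hDne : D.Nonempty := by
    obtain ⟨c, hc, -⟩ := hD 0 Fin.elim0
    exact ⟨c, hc⟩
  rcases isEmpty_or_nonempty K with hK | hK
  · obtain ⟨c, hc⟩ := hDne
    have e : f c = f b₀ := by ext x; exact hK.elim x
    have := hDC hc
    simp [e] at this
    linarith
  have : Countable D := hDc
  -- the joint evaluation map
  let q : K → (Option D → ℝ) := fun k o => o.elim (f b₀ k) (fun d => f d k)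
  have hq : Continuous q := by
    refine continuous_pi fun o => ?_
    cases o with
    | none => exact (f b₀).continuous
    | some d => exact (f d).continuous
  obtain ⟨k, hk⟩ : ∃ k : ℕ → K, Dense (range fun n => (⟨q (k n), mem_range_self _⟩ : range q)) := by
    have : Nonempty (range q) := ⟨⟨q hK.some, mem_range_self _⟩⟩
    obtain ⟨u, hu⟩ := TopologicalSpace.exists_dense_seq (range q)
    choose k hk using fun n => (u n).2
    refine ⟨k, ?_⟩
    convert hu using 1
    unfold DenseRange
    congr! 3 with n
    exact Subtype.ext (hk n)
  have hS : ∀ x, ∃ y ∈ closure (range k), q y = q x := by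
    intro x
    have hcomp : IsClosed (q '' closure (range k)) :=
      ((isClosed_closure.isCompact).image hq).isClosed
    have : q x ∈ closure (q '' range k) := by
      have h1 := hk ⟨q x, mem_range_self x⟩
      have h2 := image_closure_subset_closure_image (continuous_subtype_val) (mem_image_of_mem _ h1)
      rw [← range_comp] at h2
      rw [← range_comp]
      exact h2
    exact (closure_minimal (image_mono subset_closure) hcomp) this
  choose c hcD hc using fun n : ℕ => hD n (fun i => k i)
  have hck : ∀ i, Tendsto (fun n => f (c n) (k i)) atTop (𝓝 (f b₀ (k i))) := by
    intro i
    rw [tendsto_iff_norm_sub_tendsto_zero]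
    refine squeeze_zero' (Eventually.of_forall fun _ => norm_nonneg _) ?_
      (tendsto_one_div_add_atTop_nhds_zero_nat (𝕜 := ℝ))
    filter_upwards [eventually_gt_atTop i] with n hn
    exact (hc n ⟨i, hn⟩).le
  have hpt : ∀ x, Tendsto (fun n => f (c n) x) atTop (𝓝 (f b₀ x)) := by
    intro x
    rw [tendsto_iff_ultrafilter]
    intro U hU
    obtain ⟨b, -, hb⟩ := isCompact_univ.ultrafilter_le_nhds (U.map c) (by simp)
    have hbx : ∀ y, Tendsto (fun n => f (c n) y) U (𝓝 (f b y)) := fun y =>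
      ((hf y).tendsto b).comp hb
    have hbk : ∀ i, f b (k i) = f b₀ (k i) := fun i =>
      tendsto_nhds_unique (hbx _) ((hck i).mono_left hU)
    have hbS : ∀ y ∈ closure (range k), f b y = f b₀ y := by
      intro y hy
      have : closure (range k) ⊆ {y | f b y = f b₀ y} :=
        closure_minimal (by rintro _ ⟨i, rfl⟩; exact hbk i)
          (isClosed_eq (f b).continuous (f b₀).continuous)
      exact this hy
    obtain ⟨y, hy, hyx⟩ := hS x
    have e1 : f b₀ y = f b₀ x := congrFun hyx none
    have e2 : ∀ n, f (c n) y = f (c n) x := fun n => congrFun hyx (some ⟨c n, hcD n⟩)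
    have := hbx y
    simp only [e2, hbS y hy, e1] at this
    exact this
  have := weak_conv L (fun n => f (c n)) (f b₀) M (fun n => hM _) hpt
  have h2 := (this.sub_const (L (f b₀))).abs
  rw [sub_self, abs_zero] at h2
  exact absurd (ge_of_tendsto' h2 fun n => hDC (hcD n)) (not_le.2 hε)
end

section
variable {X : Type u} [NormedAddCommGroup X] [NormedSpace ℝ X]

/-- The dual unit ball. -/
abbrev DBall (X : Type u) [NormedAddCommGroup X] [NormedSpace ℝ X] : Set (WeakDual ℝ X) :=
  {φ : WeakDual ℝ X | ∀ x, |φ x| ≤ ‖x‖}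

lemma mem_DBall {φ : WeakDual ℝ X} : φ ∈ DBall X ↔ ‖WeakDual.toStrongDual φ‖ ≤ 1 := by
  rw [ContinuousLinearMap.opNorm_le_iff zero_le_one]
  simp only [one_mul, Real.norm_eq_abs]
  rfl

lemma isCompact_DBall : IsCompact (DBall X) := by
  have := WeakDual.isCompact_closedBall (𝕜 := ℝ) (E := X) 0 1
  convert this using 1
  ext φ
  rw [mem_DBall]
  simp

/-- A strong dual element of norm at most one as a point of the ball. -/
noncomputable def mkBall (φ : StrongDual ℝ X) (h : ‖φ‖ ≤ 1) : DBall X :=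
  ⟨StrongDual.toWeakDual φ, mem_DBall.2 (by simpa using h)⟩

lemma repr_of_linear [CompleteSpace X] (a : DBall X → ℝ) (ha : Continuous a)
    (F : StrongDual ℝ (StrongDual ℝ X)) (hF : ∀ φ h, F φ = a (mkBall φ h)) :
    ∃ x : X, ∀ φ, F φ = φ x := by
  have : CompactSpace (DBall X) := isCompact_iff_compactSpace.1 isCompact_DBall
  have hmem : F ∈ closure (range (NormedSpace.inclusionInDoubleDual ℝ X)) := by
    refine (Metric.mem_closure_iff (α := StrongDual ℝ (StrongDual ℝ X))).2 ?_
    intro ε hε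
    have hcl : IsClosed {φ : DBall X | ε / 2 ≤ |a φ|} := isClosed_le continuous_const ha.abs
    obtain ⟨s, hs⟩ := hcl.isCompact.elim_finite_subfamily_closed
      (fun x : X => {φ : DBall X | (φ : WeakDual ℝ X) x = 0})
      (fun x => isClosed_eq ((WeakDual.eval_continuous x).comp continuous_subtype_val)
        continuous_const) (by
        rw [eq_empty_iff_forall_notMem]
        rintro φ ⟨h1, h2⟩
        have h0 : WeakDual.toStrongDual (φ : WeakDual ℝ X) = 0 := by
          ext x
          exact mem_iInter.1 h2 x
        have e : φ = mkBall 0 (by simp) := Subtype.ext h0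
        have h3 := hF 0 (by simp)
        rw [map_zero, ← e] at h3
        change ε / 2 ≤ |a φ| at h1
        rw [← h3, abs_zero] at h1
        linarith)
    let N : Submodule ℝ (StrongDual ℝ X) :=
      ⨅ x : s, (NormedSpace.inclusionInDoubleDual ℝ X x).toLinearMap.ker
    have hN : ∀ φ ∈ N, ∀ x ∈ s, φ x = 0 := by
      intro φ hφ x hx
      have := (Submodule.mem_iInf _).1 hφ ⟨x, hx⟩
      simpa using this
    have hbd : ∀ φ ∈ N, |F φ| ≤ ε / 2 * ‖φ‖ := by
      intro φ hφ
      rcases eq_or_ne φ 0 with rfl | hne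
      · simp
      have hpos : 0 < ‖φ‖ := norm_pos_iff.2 hne
      have hn : ‖(‖φ‖⁻¹ • φ)‖ ≤ 1 := by
        rw [norm_smul, norm_inv, norm_norm, inv_mul_cancel₀ hpos.ne']
      by_contra! hlt
      have hm : mkBall _ hn ∈ ({φ : DBall X | ε / 2 ≤ |a φ|} ∩
          ⋂ x ∈ s, {φ : DBall X | (φ : WeakDual ℝ X) x = 0}) := by
        refine ⟨?_, ?_⟩
        · change ε / 2 ≤ |a _|
          rw [← hF, map_smul, smul_eq_mul, abs_mul, abs_inv, abs_norm, inv_mul_eq_div,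
            le_div_iff₀ hpos]
          exact hlt.le
        · simp only [mem_iInter]
          intro x hx
          have : (‖φ‖⁻¹ • φ) x = 0 := by simp [hN φ hφ x hx]
          exact this
      rw [hs] at hm
      exact hm
    obtain ⟨G, hG, hGn⟩ := exists_extension_norm_eq N (F.comp N.subtypeL)
    have hGle : ‖G‖ ≤ ε / 2 := by
      rw [hGn]
      refine ContinuousLinearMap.opNorm_le_bound _ (by positivity) fun φ => ?_
      exact hbd φ φ.2
    have hsp : (F - G).toLinearMap ∈ Submodule.span ℝ (range fun x : s =>
        (NormedSpace.inclusionInDoubleDual ℝ X x).toLinearMap) := by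
      refine mem_span_of_iInf_ker_le_ker fun φ hφ => ?_
      have := hG ⟨φ, hφ⟩
      simp only [LinearMap.mem_ker]
      change F φ - G φ = 0
      rw [sub_eq_zero]
      exact this.symm
    have hsp2 : (F - G).toLinearMap ∈ LinearMap.range
        ((ContinuousLinearMap.coeLM ℝ).comp
          (NormedSpace.inclusionInDoubleDual ℝ X).toLinearMap) := by
      refine (Submodule.span_le.2 ?_) hsp
      rintro _ ⟨x, rfl⟩
      exact ⟨x, rfl⟩
    obtain ⟨x, hx⟩ := hsp2
    refine ⟨_, ⟨x, rfl⟩, ?_⟩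
    have hx' : NormedSpace.inclusionInDoubleDual ℝ X x = F - G :=
      ContinuousLinearMap.coe_injective hx
    rw [hx']
    refine lt_of_eq_of_lt (dist_eq_norm (E := StrongDual ℝ (StrongDual ℝ X)) F (F - G)) ?_
    have e : F - (F - G) = G := by
      ext φ
      change F φ - (F φ - G φ) = G φ
      ring
    have e2 : ‖F - (F - G)‖ = ‖G‖ := congrArg norm e
    exact lt_of_eq_of_lt e2 (by linarith)
  have hclosed : IsClosed (range (NormedSpace.inclusionInDoubleDual ℝ X)) := by
    have hi := Isometry.isClosedEmbedding (α := X) (γ := StrongDual ℝ (StrongDual ℝ X))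
      (NormedSpace.inclusionInDoubleDualLi ℝ (E := X)).isometry
    exact hi.isClosed_range
  rw [hclosed.closure_eq] at hmem
  obtain ⟨x, rfl⟩ := hmem
  exact ⟨x, fun φ => rfl⟩

lemma exists_linear (a : DBall X → ℝ) (ha : Continuous a)
    (haff : ∀ (φ ψ χ : DBall X) (t : ℝ), t ∈ Icc (0 : ℝ) 1 →
      (χ : WeakDual ℝ X) = t • (φ : WeakDual ℝ X) + (1 - t) • (ψ : WeakDual ℝ X) →
      a χ = t * a φ + (1 - t) * a ψ)
    (h0 : a (mkBall 0 (by simp)) = 0) :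
    ∃ F : StrongDual ℝ (StrongDual ℝ X), ∀ φ h, F φ = a (mkBall φ h) := by
  classical
  have : CompactSpace (DBall X) := isCompact_iff_compactSpace.1 isCompact_DBall
  let A : StrongDual ℝ X → ℝ := fun φ => if h : ‖φ‖ ≤ 1 then a (mkBall φ h) else 0
  have hA : ∀ φ h, A φ = a (mkBall φ h) := fun φ h => dif_pos h
  have hA0 : A 0 = 0 := by rw [hA 0 (by simp)]; exact h0
  have hAaff : ∀ φ ψ t, ‖φ‖ ≤ 1 → ‖ψ‖ ≤ 1 → 0 ≤ t → t ≤ 1 →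
      A (t • φ + (1 - t) • ψ) = t * A φ + (1 - t) * A ψ := by
    intro φ ψ t h1 h2 h3 h4
    have h5 : ‖t • φ + (1 - t) • ψ‖ ≤ 1 := by
      refine (norm_add_le _ _).trans ?_
      rw [norm_smul, norm_smul, Real.norm_of_nonneg h3, Real.norm_of_nonneg (by linarith)]
      nlinarith [norm_nonneg φ, norm_nonneg ψ]
    rw [hA _ h1, hA _ h2, hA _ h5]
    exact haff _ _ _ t ⟨h3, h4⟩ rfl
  have hAs : ∀ φ t, ‖φ‖ ≤ 1 → 0 ≤ t → t ≤ 1 → A (t • φ) = t * A φ := by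
    intro φ t h1 h3 h4
    have := hAaff φ 0 t h1 (by simp) h3 h4
    simpa [hA0] using this
  obtain ⟨M, hM⟩ : ∃ M, ∀ φ, |A φ| ≤ M := by
    obtain ⟨M, hM⟩ := (isCompact_range ha.abs).bddAbove
    refine ⟨max M 0, fun φ => ?_⟩
    by_cases h : ‖φ‖ ≤ 1
    · rw [hA φ h]
      exact (hM ⟨_, rfl⟩).trans (le_max_left _ _)
    · simp [A, h]
  let f : StrongDual ℝ X → ℝ := fun φ => ‖φ‖ * A (‖φ‖⁻¹ • φ)
  have hn : ∀ φ : StrongDual ℝ X, ∀ N : ℝ, 0 < N → ‖φ‖ ≤ N → ‖N⁻¹ • φ‖ ≤ 1 := by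
    intro φ N hN h
    rw [norm_smul, norm_inv, Real.norm_of_nonneg hN.le, inv_mul_le_iff₀ hN]
    simpa using h
  have hf : ∀ φ : StrongDual ℝ X, ∀ N : ℝ, 0 < N → ‖φ‖ ≤ N → f φ = N * A (N⁻¹ • φ) := by
    intro φ N hN h
    rcases eq_or_ne φ 0 with rfl | hne
    · simp [f, hA0]
    have hpos : 0 < ‖φ‖ := norm_pos_iff.2 hne
    have e : N⁻¹ • φ = (‖φ‖ / N) • (‖φ‖⁻¹ • φ) := by
      rw [smul_smul]
      congr 1
      field_simp
    rw [e, hAs _ _ (hn φ _ hpos le_rfl) (by positivity) ((div_le_one hN).2 h)]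
    simp only [f]
    field_simp
  have hadd : ∀ φ ψ, f (φ + ψ) = f φ + f ψ := by
    intro φ ψ
    have hφ := norm_nonneg φ
    have hψ := norm_nonneg ψ
    let N := ‖φ‖ + ‖ψ‖ + 1
    have hN : 0 < N := by positivity
    have h1 : ‖φ‖ ≤ N := by simp only [N]; linarith
    have h2 : ‖ψ‖ ≤ N := by simp only [N]; linarith
    rw [hf φ N hN h1, hf ψ N hN h2, hf (φ + ψ) (2 * N) (by positivity)
      ((norm_add_le _ _).trans (by linarith))]
    have e : (2 * N)⁻¹ • (φ + ψ) = (1 / 2 : ℝ) • (N⁻¹ • φ) + (1 - 1 / 2 : ℝ) • (N⁻¹ • ψ) := by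
      rw [smul_smul, smul_smul, smul_add]
      congr 2 <;> (rw [mul_inv]; norm_num)
    rw [e, hAaff _ _ _ (hn φ N hN h1) (hn ψ N hN h2) (by norm_num) (by norm_num)]
    ring
  let f' : StrongDual ℝ X →+ ℝ := AddMonoidHom.mk' f hadd
  have hcont : Continuous f' := by
    refine AddMonoidHomClass.continuous_of_bound f' M fun φ => ?_
    change |‖φ‖ * A (‖φ‖⁻¹ • φ)| ≤ M * ‖φ‖
    rw [abs_mul, abs_norm, mul_comm]
    exact mul_le_mul_of_nonneg_right (hM _) (norm_nonneg _)
  refine ⟨f'.toRealLinearMap hcont, fun φ h => ?_⟩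
  change f φ = _
  rw [hf φ 1 one_pos h, ← hA φ h]
  simp

lemma exists_repr [CompleteSpace X] (a : DBall X → ℝ) (ha : Continuous a)
    (haff : ∀ (φ ψ χ : DBall X) (t : ℝ), t ∈ Icc (0 : ℝ) 1 →
      (χ : WeakDual ℝ X) = t • (φ : WeakDual ℝ X) + (1 - t) • (ψ : WeakDual ℝ X) →
      a χ = t * a φ + (1 - t) * a ψ) :
    ∃ x : X, ∀ φ h, a (mkBall φ h) - a (mkBall 0 (by simp)) = φ x := by
  have hb : Continuous fun φ => a φ - a (mkBall 0 (by simp)) := ha.sub continuous_const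
  obtain ⟨F, hF⟩ := exists_linear (fun φ => a φ - a (mkBall 0 (by simp))) hb
    (by
      intro φ ψ χ t ht h
      simp only [haff φ ψ χ t ht h]
      ring) (by simp)
  obtain ⟨x, hx⟩ := repr_of_linear _ hb F hF
  exact ⟨x, fun φ h => (hF φ h).symm.trans (hx φ)⟩

lemma weakSpace_eval_continuous {Y : Type*} [NormedAddCommGroup Y] [NormedSpace ℝ Y]
    (g : StrongDual ℝ Y) : Continuous fun y : WeakSpace ℝ Y => g ((toWeakSpace ℝ Y).symm y) :=
  WeakBilin.eval_continuous (topDualPairing ℝ Y).flip g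

lemma continuous_to_weakSpace {Y α : Type*} [NormedAddCommGroup Y] [NormedSpace ℝ Y]
    [TopologicalSpace α] (f : α → Y) (h : ∀ g : StrongDual ℝ Y, Continuous fun b => g (f b)) :
    Continuous fun b => toWeakSpace ℝ Y (f b) :=
  WeakBilin.continuous_of_continuous_eval (topDualPairing ℝ Y).flip h

lemma backward [CompleteSpace X] {Y : Type u} [NormedAddCommGroup Y] [NormedSpace ℝ Y]
    (h : DBall X → WeakSpace ℝ Y) (hc : Continuous h) (hinj : Function.Injective h)
    (haff : ∀ (φ ψ χ : DBall X) (t : ℝ), t ∈ Icc (0 : ℝ) 1 →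
      (χ : WeakDual ℝ X) = t • (φ : WeakDual ℝ X) + (1 - t) • (ψ : WeakDual ℝ X) →
      h χ = t • h φ + (1 - t) • h ψ) :
    ∃ K : Set X, IsCompact (⇑(toWeakSpace ℝ X) '' K) ∧
        (Submodule.span ℝ K).topologicalClosure = ⊤ := by
  let p : DBall X → Y := fun φ => (toWeakSpace ℝ Y).symm (h φ)
  have hS : ∀ g : StrongDual ℝ Y, ∃ x : X, ∀ φ hφ,
      g (p (mkBall φ hφ)) - g (p (mkBall 0 (by simp))) = φ x := by
    intro g
    refine exists_repr (fun φ => g (p φ)) ((weakSpace_eval_continuous g).comp hc) ?_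
    intro φ ψ χ t ht e
    simp [p, haff φ ψ χ t ht e]
  choose S hS using hS
  have hscale : ∀ φ : StrongDual ℝ X, ‖(‖φ‖ + 1)⁻¹ • φ‖ ≤ 1 := by
    intro φ
    have hN : 0 < ‖φ‖ + 1 := by positivity
    rw [norm_smul, norm_inv, Real.norm_of_nonneg hN.le, inv_mul_le_iff₀ hN]
    linarith
  have hφS : ∀ (φ : StrongDual ℝ X) g, φ (S g) = (‖φ‖ + 1) *
      (g (p (mkBall _ (hscale φ))) - g (p (mkBall 0 (by simp)))) := by
    intro φ g
    have hN : (‖φ‖ + 1) ≠ 0 := by positivity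
    rw [hS]
    simp
    field_simp
  refine ⟨S '' {g | ‖g‖ ≤ 1}, ?_, ?_⟩
  · have hcS : Continuous fun g : WeakDual ℝ Y => toWeakSpace ℝ X (S (WeakDual.toStrongDual g)) := by
      refine continuous_to_weakSpace _ fun φ => ?_
      simp only [hφS]
      exact continuous_const.mul
        ((WeakDual.eval_continuous _).sub (WeakDual.eval_continuous _))
    have := (WeakDual.isCompact_closedBall (𝕜 := ℝ) (E := Y) 0 1).image hcS
    convert this using 1
    ext x
    constructor
    · rintro ⟨_, ⟨g, hg, rfl⟩, rfl⟩
      exact ⟨StrongDual.toWeakDual g, by simpa using hg, rfl⟩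
    · rintro ⟨g, hg, rfl⟩
      exact ⟨_, ⟨WeakDual.toStrongDual g, by simpa using hg, rfl⟩, rfl⟩
  · rw [Submodule.eq_top_iff']
    intro x
    by_contra hx
    obtain ⟨φ, r, h1, h2⟩ := geometric_hahn_banach_closed_point
      (Submodule.convex (Submodule.span ℝ (S '' {g | ‖g‖ ≤ 1})).topologicalClosure)
      (Submodule.isClosed_topologicalClosure _) hx
    have hz : ∀ y ∈ (Submodule.span ℝ (S '' {g | ‖g‖ ≤ 1})).topologicalClosure, φ y = 0 := by
      intro y hy
      by_contra hne
      have := h1 ((r / φ y) • y) (Submodule.smul_mem _ _ hy)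
      rw [map_smul, smul_eq_mul, div_mul_cancel₀ _ hne] at this
      exact lt_irrefl _ this
    have hpe : p (mkBall _ (hscale φ)) = p (mkBall 0 (by simp)) := by
      by_contra hne
      obtain ⟨g, hg, hg'⟩ := exists_dual_vector ℝ _ (norm_ne_zero_iff.2 (sub_ne_zero.2 hne))
      have := hz (S g) (Submodule.le_topologicalClosure _
        (Submodule.subset_span ⟨g, hg.le, rfl⟩))
      rw [hφS, ← map_sub, hg'] at this
      rcases mul_eq_zero.1 this with h' | h'
      · have := norm_nonneg φ
        linarith
      · simp [sub_eq_zero] at h'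
        exact hne h'
    have := hinj ((toWeakSpace ℝ Y).symm.injective hpe)
    have h3 : (‖φ‖ + 1)⁻¹ • φ = 0 := congrArg (fun b : DBall X => WeakDual.toStrongDual b.1) this
    have hN : (‖φ‖ + 1)⁻¹ ≠ 0 := by positivity
    have h4 : φ = 0 := (smul_eq_zero.1 h3).resolve_left hN
    have h5 := h1 0 (Submodule.zero_mem _)
    simp [h4] at h5 h2
    linarith

lemma weak_bounded (K : Set X) (hK : IsCompact (⇑(toWeakSpace ℝ X) '' K)) :
    ∃ R, ∀ k ∈ K, ‖k‖ ≤ R := by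
  obtain ⟨R, hR⟩ := banach_steinhaus (g := fun k : K => NormedSpace.inclusionInDoubleDual ℝ X k)
    (by
      intro φ
      obtain ⟨C, hC⟩ := (hK.image (weakSpace_eval_continuous φ).abs).bddAbove
      refine ⟨C, fun k => hC ⟨_, ⟨k, k.2, rfl⟩, ?_⟩⟩
      simp)
  refine ⟨R, fun k hk => ?_⟩
  have := hR ⟨k, hk⟩
  rwa [show ‖NormedSpace.inclusionInDoubleDual ℝ X k‖ = ‖k‖ from
    (NormedSpace.inclusionInDoubleDualLi ℝ (E := X)).norm_map k] at this

lemma forward (K : Set X) (hK : IsCompact (⇑(toWeakSpace ℝ X) '' K))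
    (hd : (Submodule.span ℝ K).topologicalClosure = ⊤) :
    ∃ (Y : Type u) (_ : NormedAddCommGroup Y), ∃ (_ : NormedSpace ℝ Y)
        (_ : CompleteSpace Y), ∃ K : Set (WeakSpace ℝ Y), Convex ℝ K ∧ IsCompact K ∧
          ∃ h : DBall X ≃ₜ ↥K,
            ∀ (φ ψ χ : DBall X) (t : ℝ),
              t ∈ Set.Icc (0:ℝ) 1 →
              (χ : WeakDual ℝ X) = t • (φ : WeakDual ℝ X) + (1-t) • (ψ : WeakDual ℝ X) →
              (h χ : WeakSpace ℝ Y) = t • (h φ : WeakSpace ℝ Y) +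
                (1-t) • (h ψ : WeakSpace ℝ Y) := by
  have : CompactSpace (DBall X) := isCompact_iff_compactSpace.1 isCompact_DBall
  let KK : Set (WeakSpace ℝ X) := ⇑(toWeakSpace ℝ X) '' K
  have : CompactSpace KK := isCompact_iff_compactSpace.1 hK
  obtain ⟨R, hR⟩ := weak_bounded K hK
  let f : DBall X → C(KK, ℝ) := fun φ =>
    ⟨fun k => WeakDual.toStrongDual φ.1 ((toWeakSpace ℝ X).symm k.1),
      (weakSpace_eval_continuous _).comp continuous_subtype_val⟩
  have hfa : ∀ φ k, f φ k = φ.1 ((toWeakSpace ℝ X).symm k.1) := fun φ k => rfl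
  have hcont : ∀ L : StrongDual ℝ C(KK, ℝ), Continuous fun φ => L (f φ) := by
    intro L
    refine grothendieck L f (fun k => ?_) (max R 0) fun φ => ?_
    · exact (WeakDual.eval_continuous _).comp continuous_subtype_val
    · refine (ContinuousMap.norm_le _ (le_max_right _ _)).2 ?_
      rintro ⟨_, k, hk, rfl⟩
      refine le_trans ?_ ((hR k hk).trans (le_max_left _ _))
      exact φ.2 k
  have hT := continuous_to_weakSpace f hcont
  have hinj : Function.Injective fun φ => toWeakSpace ℝ C(KK, ℝ) (f φ) := by
    intro φ ψ e
    have e' : f φ = f ψ := (toWeakSpace ℝ C(KK, ℝ)).injective e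
    apply Subtype.ext
    apply WeakDual.toStrongDual.injective
    refine ContinuousLinearMap.ext_on (Submodule.dense_iff_topologicalClosure_eq_top.2 hd) ?_
    intro k hk
    exact congrArg (fun F : C(KK, ℝ) => F ⟨_, k, hk, rfl⟩) e'
  have haff : ∀ (φ ψ χ : DBall X) (t : ℝ),
      (χ : WeakDual ℝ X) = t • (φ : WeakDual ℝ X) + (1-t) • (ψ : WeakDual ℝ X) →
      f χ = t • f φ + (1 - t) • f ψ := by
    intro φ ψ χ t e
    ext k
    rw [hfa, e]
    rfl
  refine ⟨C(KK, ℝ), inferInstance, inferInstance, inferInstance,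
    range fun φ => toWeakSpace ℝ C(KK, ℝ) (f φ), ?_, isCompact_range hT, ?_⟩
  · rintro _ ⟨φ, rfl⟩ _ ⟨ψ, rfl⟩ s t hs ht hst
    obtain rfl : t = 1 - s := by linarith
    have hm : s • (φ : WeakDual ℝ X) + (1 - s) • (ψ : WeakDual ℝ X) ∈ DBall X := by
      intro x
      have h1 := φ.2 x
      have h2 := ψ.2 x
      change |s * φ.1 x + (1 - s) * ψ.1 x| ≤ ‖x‖
      rw [abs_le] at *
      constructor <;> nlinarith
    refine ⟨⟨_, hm⟩, ?_⟩
    simp only [haff φ ψ ⟨_, hm⟩ s rfl, map_add, map_smul]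
  · have hc : Continuous (Equiv.ofInjective _ hinj) := hT.subtype_mk _
    refine ⟨hc.homeoOfEquivCompactToT2, fun φ ψ χ t _ e => ?_⟩
    change toWeakSpace ℝ C(KK, ℝ) (f χ) = t • toWeakSpace ℝ C(KK, ℝ) (f φ) +
      (1 - t) • toWeakSpace ℝ C(KK, ℝ) (f ψ)
    rw [haff φ ψ χ t e, map_add, map_smul, map_smul]
end
end

/-- a real Banach space `X` is weakly compactly generated iff its dual
unit ball with the weak* topology is affinely homeomorphic to a convex weakly compact
subset of some real Banach space `Y`. The dual ball is modelled as
`{φ : WeakDual ℝ X | ∀ x, |φ x| ≤ ‖x‖}` (with the subspace topology of the weak*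
topology), and weak compactness in `Y` via the type synonym `WeakSpace ℝ Y`. -/
theorem statement17 {X : Type u} [NormedAddCommGroup X] [NormedSpace ℝ X]
    [CompleteSpace X] :
    (∃ K : Set X, IsCompact (⇑(toWeakSpace ℝ X) '' K) ∧
        (Submodule.span ℝ K).topologicalClosure = ⊤) ↔
      ∃ (Y : Type u) (_ : NormedAddCommGroup Y), ∃ (_ : NormedSpace ℝ Y)
        (_ : CompleteSpace Y), ∃ K : Set (WeakSpace ℝ Y), Convex ℝ K ∧ IsCompact K ∧
          ∃ h : ↥{φ : WeakDual ℝ X | ∀ x, |φ x| ≤ ‖x‖} ≃ₜ ↥K,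
            ∀ (φ ψ χ : ↥{φ : WeakDual ℝ X | ∀ x, |φ x| ≤ ‖x‖}) (t : ℝ),
              t ∈ Set.Icc (0:ℝ) 1 →
              (χ : WeakDual ℝ X) = t • (φ : WeakDual ℝ X) + (1-t) • (ψ : WeakDual ℝ X) →
              (h χ : WeakSpace ℝ Y) = t • (h φ : WeakSpace ℝ Y) +
                (1-t) • (h ψ : WeakSpace ℝ Y) := by
  constructor
  · rintro ⟨K, hK, hd⟩
    exact forward K hK hd
  · rintro ⟨Y, _, _, _, K, -, -, h, haff⟩
    exact backward (fun φ => (h φ : WeakSpace ℝ Y)) (continuous_subtype_val.comp h.continuous)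
      (Subtype.val_injective.comp h.injective) haff

end
end
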